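/- Fix integers k ≥ 2, r ≥ 3 and t with 2 ≤ t ≤ r−1, and fix an r-graph F on m vertices which is (k(r−t)+t, k)-free and also (ℓ(r−t)+t−1, ℓ)-free for every ℓ with 2 ≤ ℓ ≤ k−1. Then the liminf over n of n^{-t} f^{(r)}(n; k(r−t)+t, k) is at least |F| / m^t, where |F| denotes the number of edges of F. -/

import Mathlib

open Finset Filter

/-- An `r`-graph is `(s,k)`-free if it has no `k` distinct edges spanning at most `s` vertices. -/
def IsFree {V : Type*} [DecidableEq V] (G : Finset (Finset V)) (s k : ℕ) : Prop :=
  ¬ ∃ S ⊆ G, S.card = k ∧ (S.sup id).card ≤ s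

/-- `exNum r n s k` is the maximum number of edges of an `(s,k)`-free `r`-uniform
hypergraph on `n` vertices, i.e. `f^{(r)}(n; s, k)`. -/
noncomputable def exNum (r n s k : ℕ) : ℕ :=
  sSup {m : ℕ | ∃ G : Finset (Finset (Fin n)),
    (∀ e ∈ G, e.card = r) ∧ IsFree G s k ∧ G.card = m}

/-! ### The random greedy process -/

section RandomGreedy

variable {β : Type*}

/-- The set of elements accepted during the first `j` rounds: an element with label `j` is accepted
in round `j` unless it completes a conflict with elements accepted earlier or labelled `j`. -/
def accepted (Cf : Finset β → Prop) (ω : β → ℕ) : ℕ → Set β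
  | 0 => ∅
  | j + 1 => accepted Cf ω j ∪
      {b | ω b = j ∧ ∀ C, Cf C → b ∈ C → ∃ b' ∈ C, b' ≠ b ∧ b' ∉ accepted Cf ω j ∧ ω b' ≠ j}

variable {Cf : Finset β → Prop} {ω ω' : β → ℕ}

lemma mem_accepted_succ {j : ℕ} {b : β} : b ∈ accepted Cf ω (j + 1) ↔ b ∈ accepted Cf ω j ∨
    (ω b = j ∧ ∀ C, Cf C → b ∈ C → ∃ b' ∈ C, b' ≠ b ∧ b' ∉ accepted Cf ω j ∧ ω b' ≠ j) :=
  Iff.rfl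

lemma label_lt_of_mem_accepted {j : ℕ} {b : β} (h : b ∈ accepted Cf ω j) : ω b < j := by
  induction j with
  | zero => exact absurd h (by simp [accepted])
  | succ j ih =>
    rcases mem_accepted_succ.1 h with h | h
    · exact (ih h).trans (Nat.lt_succ_self j)
    · omega

lemma accepted_mono : Monotone (accepted Cf ω) :=
  monotone_nat_of_le_succ fun _ => Set.subset_union_left

lemma mem_accepted_label_succ {j : ℕ} {b : β} (h : b ∈ accepted Cf ω j) :
    b ∈ accepted Cf ω (ω b + 1) := by
  induction j with
  | zero => exact absurd h (by simp [accepted])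
  | succ j ih =>
    rcases mem_accepted_succ.1 h with h' | h'
    · exact ih h'
    · rw [h'.1]; exact h

lemma not_subset_accepted {C : Finset β} (hC : Cf C) (hne : C.Nonempty) (J : ℕ) :
    ¬ ∀ b ∈ C, b ∈ accepted Cf ω J := by
  intro h
  obtain ⟨b, hb, hmax⟩ := C.exists_max_image ω hne
  rcases mem_accepted_succ.1 (mem_accepted_label_succ (h b hb)) with h' | h'
  · exact lt_irrefl _ (label_lt_of_mem_accepted h')
  · obtain ⟨b', hb', -, hna, hne'⟩ := h'.2 C hC hb
    exact hna (accepted_mono (lt_of_le_of_ne (hmax b' hb') hne')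
      (mem_accepted_label_succ (h b' hb')))

lemma accepted_congr {j : ℕ} (h : ∀ b, ω b < j ∨ ω' b < j → ω b = ω' b) :
    accepted Cf ω j = accepted Cf ω' j := by
  induction j with
  | zero => rfl
  | succ j ih =>
    have hih := ih fun b hb => h b (by omega)
    have hj : ∀ b, ω b = j ↔ ω' b = j := fun b => by
      constructor
      · intro hb; rw [← h b (by omega)]; exact hb
      · intro hb; rw [h b (by omega)]; exact hb
    ext b
    simp only [mem_accepted_succ, hih, hj, ne_eq]

lemma accepted_comp_equiv (τ : β ≃ β) (hτ : ∀ C, Cf (C.map τ.toEmbedding) ↔ Cf C) (j : ℕ) (b : β) :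
    τ b ∈ accepted Cf ω j ↔ b ∈ accepted Cf (ω ∘ τ) j := by
  induction j generalizing b with
  | zero => simp [accepted]
  | succ j ih =>
    rw [mem_accepted_succ, mem_accepted_succ, ih]
    refine or_congr Iff.rfl (and_congr Iff.rfl ?_)
    constructor
    · intro h C hC hb
      obtain ⟨b', hb', h1, h2, h3⟩ := h _ ((hτ C).2 hC) (Finset.mem_map_of_mem _ hb)
      obtain ⟨x, hx, rfl⟩ := Finset.mem_map.1 hb'
      exact ⟨x, hx, fun e => h1 (by rw [e]; rfl), fun e => h2 ((ih x).2 e), h3⟩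
    · intro h C hC hb
      have hC' : Cf (C.map τ.symm.toEmbedding) := by
        rw [← hτ, Finset.map_map]
        convert hC
        ext x; simp
      obtain ⟨x, hx, h1, h2, h3⟩ := h _ hC' (by simpa using hb)
      refine ⟨τ x, by simpa using hx, fun e => h1 (τ.injective e), fun e => h2 ((ih x).1 e), h3⟩

/-- The elements that can be reached from `b` in at most `i` steps through conflicts all of whose
further elements lie in `O`. -/
def reach (Cf : Finset β → Prop) (O : Set β) : ℕ → β → Set β
  | 0, b => {b}
  | i + 1, b => {b} ∪ {z | ∃ C, Cf C ∧ b ∈ C ∧ (∀ x ∈ C, x ≠ b → x ∈ O) ∧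
      ∃ x ∈ C, z ∈ reach Cf O i x}

variable {O : Set β}

lemma self_mem_reach (i : ℕ) (b : β) : b ∈ reach Cf O i b := by
  cases i with
  | zero => rfl
  | succ i => exact Or.inl rfl

lemma reach_subset_succ (i : ℕ) (b : β) : reach Cf O i b ⊆ reach Cf O (i + 1) b := by
  induction i generalizing b with
  | zero => exact fun z hz => Or.inl hz
  | succ i ih =>
    rintro z (hz | ⟨C, h1, h2, h3, x, hx, hz⟩)
    · exact Or.inl hz
    · exact Or.inr ⟨C, h1, h2, h3, x, hx, ih x hz⟩

lemma mem_accepted_of_agree {J : ℕ} (hO : ∀ b, ω b < J → b ∈ O) (hO' : ∀ b, ω' b < J → b ∈ O)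
    {j : ℕ} (hj : j ≤ J) {b : β} (h : ∀ z ∈ reach Cf O j b, ω z = ω' z) :
    b ∈ accepted Cf ω j ↔ b ∈ accepted Cf ω' j := by
  induction j generalizing b with
  | zero => exact Iff.rfl
  | succ j ih =>
    have h0 : ω b = ω' b := h b (self_mem_reach _ _)
    have key : ∀ C, Cf C → b ∈ C → (∀ x ∈ C, x ≠ b → x ∈ O) →
        ∀ x ∈ C, (x ∈ accepted Cf ω j ↔ x ∈ accepted Cf ω' j) ∧ ω x = ω' x := by
      intro C hC hb hCO x hx
      have hx' : ∀ z ∈ reach Cf O j x, ω z = ω' z := fun z hz =>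
        h z (Or.inr ⟨C, hC, hb, hCO, x, hx, hz⟩)
      exact ⟨ih (by omega) hx', hx' x (self_mem_reach _ _)⟩
    rw [mem_accepted_succ, mem_accepted_succ,
      ih (by omega) fun z hz => h z (reach_subset_succ _ _ hz), h0]
    refine or_congr Iff.rfl (and_congr Iff.rfl ?_)
    constructor
    · intro H C hC hb
      by_contra! hcon
      have hCO : ∀ x ∈ C, x ≠ b → x ∈ O := by
        intro x hx hxb
        apply hO'
        by_cases hxa : x ∈ accepted Cf ω' j
        · have := label_lt_of_mem_accepted hxa; omega
        · have := hcon x hx hxb hxa; omega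
      obtain ⟨x, hx, h1, h2, h3⟩ := H C hC hb
      obtain ⟨k1, k2⟩ := key C hC hb hCO x hx
      exact h3 (k2.trans (hcon x hx h1 fun e => h2 (k1.2 e)))
    · intro H C hC hb
      by_contra! hcon
      have hCO : ∀ x ∈ C, x ≠ b → x ∈ O := by
        intro x hx hxb
        apply hO
        by_cases hxa : x ∈ accepted Cf ω j
        · have := label_lt_of_mem_accepted hxa; omega
        · have := hcon x hx hxb hxa; omega
      obtain ⟨x, hx, h1, h2, h3⟩ := H C hC hb
      obtain ⟨k1, k2⟩ := key C hC hb hCO x hx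
      exact h3 (k2.symm.trans (hcon x hx h1 fun e => h2 (k1.1 e)))

variable [DecidableEq β]

/-- Unions of conflicts in which every conflict meets the union of the preceding ones. -/
inductive Linked (Cf : Finset β → Prop) : Finset β → Prop
  | single (b : β) : Linked Cf {b}
  | step (U C : Finset β) : Linked Cf U → Cf C → (U ∩ C).Nonempty → Linked Cf (U ∪ C)

lemma Linked.union {U U' : Finset β} (hU : Linked Cf U) (hU' : Linked Cf U')
    (h : (U ∩ U').Nonempty) : Linked Cf (U ∪ U') := by
  induction hU' generalizing U with
  | single b =>
    obtain ⟨x, hx⟩ := h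
    rw [Finset.mem_inter, Finset.mem_singleton] at hx
    rwa [Finset.union_eq_left.2 (by simpa [← hx.2] using hx.1)]
  | step U' C hU' hC hne ih =>
    by_cases h' : (U ∩ U').Nonempty
    · rw [← Finset.union_assoc]
      refine (ih hU h').step _ _ hC ?_
      obtain ⟨x, hx⟩ := hne
      simp only [Finset.mem_inter] at hx
      exact ⟨x, by simp [hx]⟩
    · have h2 : (U ∩ C).Nonempty := by
        obtain ⟨x, hx⟩ := h
        simp only [Finset.mem_inter, Finset.mem_union] at hx
        rcases hx.2 with h3 | h3
        · exact absurd ⟨x, Finset.mem_inter.2 ⟨hx.1, h3⟩⟩ h'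
        · exact ⟨x, Finset.mem_inter.2 ⟨hx.1, h3⟩⟩
      have h4 := ih (hU.step _ _ hC h2) (by
        obtain ⟨x, hx⟩ := hne
        simp only [Finset.mem_inter] at hx
        exact ⟨x, by simp [hx]⟩)
      rwa [Finset.union_assoc, Finset.union_comm C] at h4

lemma exists_linked_of_mem_reach {k : ℕ} (hk : ∀ C, Cf C → C.card ≤ k) {i : ℕ} {b z : β}
    (h : z ∈ reach Cf O i b) :
    ∃ U, Linked Cf U ∧ b ∈ U ∧ z ∈ U ∧ (∀ x ∈ U, x ≠ b → x ∈ O) ∧ U.card ≤ 1 + i * k := by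
  have triv : z = b → ∃ U, Linked Cf U ∧ b ∈ U ∧ z ∈ U ∧ (∀ x ∈ U, x ≠ b → x ∈ O) ∧
      U.card ≤ 1 + i * k := by
    rintro rfl
    exact ⟨{z}, .single z, by simp, by simp, by simp, by simp⟩
  induction i generalizing b with
  | zero => exact triv h
  | succ i ih =>
    rcases h with h | ⟨C, hC, hb, hCO, x, hx, hz⟩
    · exact triv h
    · obtain ⟨U, hU, hxU, hzU, hUO, hcard⟩ := ih hz (by
        rintro rfl
        exact ⟨{z}, .single z, by simp, by simp, by simp, by simp⟩)
      refine ⟨U ∪ C, hU.step _ _ hC ⟨x, by simp [hxU, hx]⟩, by simp [hb], by simp [hzU], ?_, ?_⟩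
      · intro y hy hyb
        rcases Finset.mem_union.1 hy with hy | hy
        · by_cases e : y = x
          · subst e; exact hCO y hx hyb
          · exact hUO y hy e
        · exact hCO y hy hyb
      · have := Finset.card_union_le U C
        have := hk C hC
        rw [Nat.succ_mul]; omega

lemma accepted_update_of_le {B : β} {J j : ℕ} (hj : j ≤ J) (h : j ≤ ω B) :
    accepted Cf (Function.update ω B J) j = accepted Cf ω j := by
  refine accepted_congr fun b hb => ?_
  by_cases e : b = B
  · subst e
    rw [Function.update_self] at hb
    omega
  · rw [Function.update_of_ne e]

end RandomGreedy

/-! ### Uniform probability on finite types -/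

section Probability

open Classical in
/-- The proportion of the elements of a finite type that satisfy `E`. -/
noncomputable def prob {Ω : Type*} [Fintype Ω] (E : Ω → Prop) : ℝ :=
  ((univ.filter E).card : ℝ) / Fintype.card Ω

variable {Ω : Type*} [Fintype Ω]

lemma prob_def (E : Ω → Prop) [DecidablePred E] :
    prob E = ((univ.filter E).card : ℝ) / Fintype.card Ω := by
  unfold prob
  congr!

lemma prob_nonneg (E : Ω → Prop) : 0 ≤ prob E := by unfold prob; positivity

lemma prob_mono {E E' : Ω → Prop} (h : ∀ ω, E ω → E' ω) : prob E ≤ prob E' := by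
  classical
  rw [prob_def, prob_def]
  gcongr with ω
  exact h ω

lemma prob_true [Nonempty Ω] : prob (fun _ : Ω => True) = 1 := by
  classical
  unfold prob
  simp [Finset.card_univ]

lemma prob_or_le (E E' : Ω → Prop) : prob (fun ω => E ω ∨ E' ω) ≤ prob E + prob E' := by
  classical
  rw [prob_def, prob_def, prob_def, ← add_div]
  gcongr
  rw [Finset.filter_or]
  exact_mod_cast Finset.card_union_le _ _

lemma prob_exists_le {κ : Type*} (s : Finset κ) (E : κ → Ω → Prop) :
    prob (fun ω => ∃ i ∈ s, E i ω) ≤ ∑ i ∈ s, prob (E i) := by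
  classical
  simp only [prob_def]
  rw [← Finset.sum_div]
  gcongr
  have : (univ.filter fun ω => ∃ i ∈ s, E i ω) = s.biUnion fun i => univ.filter (E i) := by
    ext ω; simp
  rw [this]
  exact_mod_cast Finset.card_biUnion_le

lemma sum_prob_le_one {κ : Type*} (s : Finset κ) (E : κ → Ω → Prop)
    (h : ∀ i ∈ s, ∀ j ∈ s, i ≠ j → ∀ ω, E i ω → ¬ E j ω) : ∑ i ∈ s, prob (E i) ≤ 1 := by
  classical
  simp only [prob_def]
  rw [← Finset.sum_div]
  apply div_le_one_of_le₀ _ (by positivity)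
  rw [← Nat.cast_sum, ← Finset.card_biUnion]
  · exact_mod_cast Finset.card_le_univ _
  · intro i hi j hj hij
    simp only [Function.onFun]
    rw [Finset.disjoint_left]
    intro ω hω hω'
    simp only [Finset.mem_filter, Finset.mem_univ, true_and] at hω hω'
    exact h i hi j hj hij ω hω hω'

lemma prob_add_prob_not [Nonempty Ω] (E : Ω → Prop) : prob E + prob (fun ω => ¬ E ω) = 1 := by
  classical
  unfold prob
  rw [← add_div, ← Nat.cast_add, Finset.card_filter_add_card_filter_not]
  simp [Finset.card_univ]

lemma prob_disjoint_add_le {E E' E'' : Ω → Prop} (h : ∀ ω, E ω → ¬ E' ω)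
    (h1 : ∀ ω, E ω → E'' ω) (h2 : ∀ ω, E' ω → E'' ω) : prob E + prob E' ≤ prob E'' := by
  classical
  unfold prob
  rw [← add_div]
  gcongr
  rw [← Nat.cast_add, ← Finset.card_union_of_disjoint]
  · norm_cast
    apply Finset.card_le_card
    intro ω hω
    simp only [Finset.mem_union, Finset.mem_filter, Finset.mem_univ, true_and] at hω ⊢
    exact hω.elim (h1 ω) (h2 ω)
  · rw [Finset.disjoint_left]
    intro ω hω hω'
    simp only [Finset.mem_filter, Finset.mem_univ, true_and] at hω hω'
    exact h ω hω hω'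

lemma prob_comp_equiv {Ω' : Type*} [Fintype Ω'] (σ : Ω ≃ Ω') (E : Ω' → Prop) :
    prob (fun ω => E (σ ω)) = prob E := by
  classical
  unfold prob
  rw [Fintype.card_congr σ]
  congr 2
  exact Finset.card_equiv σ (by simp)

lemma exists_sum_prob_le {κ : Type*} [Nonempty Ω] (s : Finset κ) (E : κ → Ω → Prop)
    [∀ ω, DecidablePred fun i => E i ω] :
    ∃ ω, ∑ i ∈ s, prob (E i) ≤ ((s.filter fun i => E i ω).card : ℝ) := by
  classical
  by_contra! hcon
  have h1 : ∑ ω : Ω, ((s.filter fun i => E i ω).card : ℝ) = Fintype.card Ω * ∑ i ∈ s, prob (E i) := by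
    simp only [prob_def]
    rw [← Finset.sum_div, mul_div_cancel₀ _ (by exact_mod_cast Fintype.card_ne_zero)]
    norm_cast
    simp only [Finset.card_filter]
    rw [Finset.sum_comm]
  have h2 := Finset.sum_lt_sum_of_nonempty (s := (univ : Finset Ω)) univ_nonempty
    fun ω _ => hcon ω
  rw [h1, Finset.sum_const, Finset.card_univ, nsmul_eq_mul] at h2
  exact lt_irrefl _ h2

variable {β R : Type*} [Fintype β] [DecidableEq β] [Fintype R]

open Classical in
lemma prob_pi (L : β → R → Prop) :
    prob (fun ω : β → R => ∀ b, L b (ω b)) = ∏ b, prob (L b) := by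
  unfold prob
  rw [Finset.prod_div_distrib]
  congr 1
  · rw [← Nat.cast_prod, ← Fintype.card_piFinset]
    congr 2
    ext ω; simp
  · rw [Fintype.card_pi]; push_cast; rfl

lemma prob_forall_mem [Nonempty R] (S : Finset β) (L : β → R → Prop) :
    prob (fun ω : β → R => ∀ b ∈ S, L b (ω b)) = ∏ b ∈ S, prob (L b) := by
  have h := prob_pi fun (b : β) (r : R) => b ∈ S → L b r
  rw [h, ← Finset.prod_subset (Finset.subset_univ S)]
  · refine Finset.prod_congr rfl fun b hb => ?_
    simp [hb]
  · intro b _ hb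
    simp only [hb, false_imp_iff]
    exact prob_true

lemma prob_independent {ι : Type*} [Fintype ι] [DecidableEq ι] (f : ι → (β → R) → Prop) :
    prob (fun ω : β → ι → R => ∀ g, f g fun b => ω b g) = ∏ g, prob (f g) := by
  rw [← prob_pi, ← prob_comp_equiv (Equiv.piComm fun (_ : β) (_ : ι) => R)]
  rfl

lemma prob_marginal {ι : Type*} [Fintype ι] [DecidableEq ι] [Nonempty R] (g₀ : ι)
    (f : (β → R) → Prop) :
    prob (fun ω : β → ι → R => f fun b => ω b g₀) = prob f := by
  have h := prob_independent (β := β) (R := R) fun (g : ι) (ω : β → R) => g = g₀ → f ω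
  rw [Finset.prod_eq_single g₀] at h
  · simpa using h
  · intro g _ hg
    simp only [hg, false_imp_iff]
    exact prob_true
  · simp

lemma prob_exists_coord_le {ι : Type*} [Fintype ι] [DecidableEq ι] [Nonempty R]
    (P : R → Prop) : prob (fun x : ι → R => ∃ g, P (x g)) ≤ Fintype.card ι * prob P := by
  have h := prob_exists_le (Ω := ι → R) univ fun g x => P (x g)
  simp only [Finset.mem_univ, true_and] at h
  refine h.trans (le_of_eq ?_)
  have h' : ∀ g, prob (fun x : ι → R => P (x g)) = prob P := by
    intro g
    have := prob_forall_mem (β := ι) {g} fun _ => P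
    simpa using this
  simp [h', Finset.card_univ]

/-- Decoupling: events that are determined by disjoint sets of coordinates, where these sets only
depend on the set of open coordinates, may be evaluated on independent copies. -/
lemma prob_decouple {ι : Type*} [Fintype ι] [DecidableEq ι] (g₀ : ι) (P : R → Prop)
    (Z : ι → Set β → Set β) (f : ι → (β → R) → Prop) (Good : Set β → Prop)
    (hf : ∀ g O ω ω', (∀ b, P (ω b) → b ∈ O) → (∀ b, P (ω' b) → b ∈ O) →
      (∀ b ∈ Z g O, ω b = ω' b) → (f g ω ↔ f g ω'))
    (hGood : ∀ O, Good O → ∀ g g' z, z ∈ Z g O → z ∈ Z g' O → g = g') :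
    prob (fun ω : β → ι → R => Good {b | ∃ g, P (ω b g)} ∧ ∀ g, f g fun b => ω b g) =
    prob (fun ω : β → ι → R => Good {b | ∃ g, P (ω b g)} ∧ ∀ g, f g fun b => ω b g₀) := by
  classical
  set opens : (β → ι → R) → Set β := fun ω => {b | ∃ g, P (ω b g)} with hopens
  set perm : Set β → β → Equiv.Perm ι := fun O b =>
    if h : ∃ g, b ∈ Z g O then Equiv.swap g₀ h.choose else 1 with hperm
  have hinv : ∀ O b g, perm O b (perm O b g) = g := by
    intro O b g
    simp only [hperm]
    split_ifs <;> simp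
  set Φ : (β → ι → R) → (β → ι → R) := fun ω b g => ω b (perm (opens ω) b g) with hΦ
  have hΦo : ∀ ω, opens (Φ ω) = opens ω := by
    intro ω
    ext b
    constructor
    · rintro ⟨g, hg⟩; exact ⟨_, hg⟩
    · rintro ⟨g, hg⟩
      refine ⟨perm (opens ω) b g, ?_⟩
      simpa only [hΦ, hinv] using hg
  have hΦΦ : Function.Involutive Φ := by
    intro ω
    funext b g
    change Φ ω b (perm (opens (Φ ω)) b g) = _
    rw [hΦo]
    simp only [hΦ, hinv]
  refine Eq.trans ?_ (prob_comp_equiv hΦΦ.toPerm _)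
  simp only [Function.Involutive.coe_toPerm]
  congr 1
  funext ω
  rw [eq_iff_iff]
  have h1 : {b | ∃ g, P (Φ ω b g)} = {b | ∃ g, P (ω b g)} := hΦo ω
  rw [h1]
  refine and_congr_right fun hG => forall_congr' fun g => ?_
  refine hf g (opens ω) _ _ (fun b hb => ⟨g, hb⟩) (fun b hb => ⟨_, hb⟩) fun b hb => ?_
  have hex : ∃ g, b ∈ Z g (opens ω) := ⟨g, hb⟩
  have hch : hex.choose = g := hGood _ hG _ _ b hex.choose_spec hb
  simp only [hΦ, hperm]
  rw [dif_pos hex, hch, Equiv.swap_apply_left]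

end Probability

/-! ### Blocks and conflicts -/

section Blocks

variable {V : Type*} [Fintype V] {N : ℕ}

/-- The coordinates on which two blocks agree. -/
def agree (b b' : V → Fin N) : Finset V := univ.filter fun v => b v = b' v

lemma mem_agree {b b' : V → Fin N} {v : V} : v ∈ agree b b' ↔ b v = b' v := by simp [agree]

variable [DecidableEq V]

/-- The vertex set of the block `b`, as a set of pairs. -/
def blockGraph (b : V → Fin N) : Finset (V × Fin N) := univ.image fun v => (v, b v)

/-- The vertices covered by a set of blocks. -/
def cover (U : Finset (V → Fin N)) : Finset (V × Fin N) := U.biUnion blockGraph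

/-- The number of covered vertices, compared with `|U| (|V| - t)`. -/
def excess (t : ℕ) (U : Finset (V → Fin N)) : ℤ :=
  (cover U).card - U.card * ((Fintype.card V : ℤ) - t)

/-- A minimal set of at least two and at most `k` blocks covering few vertices. -/
def Conflict (t k : ℕ) (C : Finset (V → Fin N)) : Prop :=
  2 ≤ C.card ∧ C.card ≤ k ∧ excess t C ≤ t ∧ ∀ S ⊂ C, 2 ≤ S.card → t < excess t S

lemma mem_blockGraph {b : V → Fin N} {x : V × Fin N} : x ∈ blockGraph b ↔ b x.1 = x.2 := by
  simp only [blockGraph, Finset.mem_image, Finset.mem_univ, true_and]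
  constructor
  · rintro ⟨v, rfl⟩; rfl
  · intro h; exact ⟨x.1, by rw [h]⟩

lemma card_blockGraph (b : V → Fin N) : (blockGraph b).card = Fintype.card V := by
  rw [blockGraph, Finset.card_image_of_injective _ fun v w h => (Prod.ext_iff.1 h).1,
    Finset.card_univ]

lemma cover_singleton (b : V → Fin N) : cover {b} = blockGraph b := by simp [cover]

lemma blockGraph_subset_cover {b : V → Fin N} {U : Finset (V → Fin N)} (h : b ∈ U) :
    blockGraph b ⊆ cover U := Finset.subset_biUnion_of_mem _ h

lemma cover_mono {U U' : Finset (V → Fin N)} (h : U ⊆ U') : cover U ⊆ cover U' :=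
  Finset.biUnion_subset_biUnion_of_subset_left _ h

lemma cover_union (U U' : Finset (V → Fin N)) : cover (U ∪ U') = cover U ∪ cover U' :=
  Finset.union_biUnion

lemma excess_singleton (t : ℕ) (b : V → Fin N) : excess t {b} = t := by
  simp [excess, cover_singleton, card_blockGraph]

lemma excess_union_add_inter_le (t : ℕ) (U U' : Finset (V → Fin N)) :
    excess t (U ∪ U') + excess t (U ∩ U') ≤ excess t U + excess t U' := by
  have h1 := Finset.card_union_add_card_inter (cover U) (cover U')
  have h2 := Finset.card_union_add_card_inter U U'
  have h3 : (cover (U ∩ U')).card ≤ (cover U ∩ cover U').card :=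
    Finset.card_le_card (Finset.subset_inter (cover_mono Finset.inter_subset_left)
      (cover_mono Finset.inter_subset_right))
  rw [← cover_union] at h1
  zify at h1 h2 h3
  unfold excess
  linear_combination h3 + h1 - ((Fintype.card V : ℤ) - t) * h2

lemma excess_insert (t : ℕ) {b : V → Fin N} {U : Finset (V → Fin N)} (h : b ∉ U) :
    excess t (insert b U) = excess t U + t - (blockGraph b ∩ cover U).card := by
  have h1 := Finset.card_union_add_card_inter (blockGraph b) (cover U)
  have h2 : cover (insert b U) = blockGraph b ∪ cover U := Finset.biUnion_insert
  rw [card_blockGraph] at h1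
  zify at h1
  unfold excess
  rw [h2, Finset.card_insert_of_notMem h]
  push_cast
  linear_combination h1

lemma Conflict.le_excess {t k : ℕ} {C S : Finset (V → Fin N)} (hC : Conflict t k C) (hS : S ⊂ C)
    (hne : S.Nonempty) : (t : ℤ) ≤ excess t S := by
  rcases Nat.lt_or_ge S.card 2 with h | h
  · obtain ⟨b, rfl⟩ := Finset.card_eq_one.1 (by have := hne.card_pos; omega : S.card = 1)
    rw [excess_singleton]
  · exact (hC.2.2.2 S hS h).le

lemma Conflict.excess_union_le {t k : ℕ} {U C : Finset (V → Fin N)} (hC : Conflict t k C)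
    (hU : excess t U ≤ t) (hne : (U ∩ C).Nonempty) : excess t (U ∪ C) ≤ t := by
  by_cases h : U ∩ C = C
  · rwa [Finset.union_eq_left.2 (Finset.inter_eq_right.1 h)]
  · have h1 := hC.le_excess (Finset.inter_subset_right.ssubset_of_ne h) hne
    have h2 := excess_union_add_inter_le t U C
    have h3 := hC.2.2.1
    linarith

lemma Linked.excess_le {t k : ℕ} {U : Finset (V → Fin N)} (hU : Linked (Conflict t k) U) :
    excess t U ≤ t := by
  induction hU with
  | single b => rw [excess_singleton]
  | step U C _ hC hne ih => exact hC.excess_union_le ih hne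

lemma Conflict.exists_subset {t k : ℕ} {S : Finset (V → Fin N)} (h2 : 2 ≤ S.card)
    (hk : S.card ≤ k) (h : excess t S ≤ t) : ∃ C ⊆ S, Conflict t k C := by
  induction hn : S.card using Nat.strong_induction_on generalizing S with
  | _ n ih =>
    by_cases hmin : ∀ S' ⊂ S, 2 ≤ S'.card → t < excess t S'
    · exact ⟨S, subset_rfl, h2, hk, h, hmin⟩
    · push Not at hmin
      obtain ⟨S', hS', h2', hex⟩ := hmin
      have hlt := Finset.card_lt_card hS'
      obtain ⟨C, hC, hCc⟩ := ih S'.card (by omega) h2' (by omega) hex rfl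
      exact ⟨C, hC.trans hS'.1, hCc⟩

lemma excess_pair (t : ℕ) {b b' : V → Fin N} (h : b ≠ b') :
    excess t {b, b'} = 2 * t - (blockGraph b ∩ blockGraph b').card := by
  rw [excess_insert t (by simpa using h), excess_singleton, cover_singleton]
  ring

lemma card_agree (b b' : V → Fin N) :
    (agree b b').card = (blockGraph b ∩ blockGraph b').card := by
  rw [← Finset.card_image_of_injective (agree b b') (f := fun v => (v, b v))
    fun v w h => (Prod.ext_iff.1 h).1]
  congr 1
  ext ⟨v, y⟩
  simp only [Finset.mem_image, mem_agree, Finset.mem_inter, mem_blockGraph, Prod.mk.injEq]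
  constructor
  · rintro ⟨w, h, rfl, rfl⟩; exact ⟨rfl, h.symm⟩
  · rintro ⟨rfl, h⟩; exact ⟨v, h.symm, rfl, rfl⟩

lemma Conflict.eq_pair_of_inter {t k : ℕ} {C : Finset (V → Fin N)} (hC : Conflict t k C)
    {B : V → Fin N} (hB : B ∈ C) {U : Finset (V → Fin N)} (hCU : C.erase B ⊆ U)
    (hU : (blockGraph B ∩ cover U).card ≤ t) :
    ∃ b, b ≠ B ∧ C = {B, b} ∧ blockGraph B ∩ blockGraph b = blockGraph B ∩ cover U ∧
      (agree B b).card = t := by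
  have hins := excess_insert t (Finset.notMem_erase B C)
  rw [Finset.insert_erase hB] at hins
  have hsub : blockGraph B ∩ cover (C.erase B) ⊆ blockGraph B ∩ cover U :=
    Finset.inter_subset_inter_left (cover_mono hCU)
  have hle := Finset.card_le_card hsub
  have hex := hC.2.2.1
  have hcard := Finset.card_erase_of_mem hB
  have h2 := hC.1
  have h1 : (C.erase B).card = 1 := by
    by_contra hne
    have := hC.2.2.2 _ (Finset.erase_ssubset hB) (by omega)
    omega
  obtain ⟨b, hb⟩ := Finset.card_eq_one.1 h1
  have hbB : b ≠ B := by
    have : b ∈ C.erase B := by rw [hb]; simp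
    exact (Finset.mem_erase.1 this).1
  rw [hb, cover_singleton] at hsub hle hins
  rw [excess_singleton] at hins
  refine ⟨b, hbB, by rw [← Finset.insert_erase hB, hb], ?_, ?_⟩
  · exact Finset.eq_of_subset_of_card_le hsub (by omega)
  · rw [card_agree]; omega

lemma Conflict.agree_eq_of_meet {t k : ℕ} {C C' U : Finset (V → Fin N)} (hC : Conflict t k C)
    (hC' : Conflict t k C') (hne : C ≠ C') {B : V → Fin N} (hB : B ∈ C) (hB' : B ∈ C')
    (hU : excess t U ≤ t) (hBU : B ∉ U) (h : (U ∩ C).Nonempty) (h' : (U ∩ C').Nonempty)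
    (hW : ∀ W ⊆ U ∪ C ∪ C', B ∈ W → (t : ℤ) ≤ excess t W) :
    ∃ b b', C = {B, b} ∧ C' = {B, b'} ∧ agree B b = agree B b' ∧ (agree B b).card = t := by
  have aux : ∀ D D' : Finset (V → Fin N), Conflict t k D → Conflict t k D' → D ≠ D' → B ∈ D →
      B ∈ D' → (U ∩ D).Nonempty → (U ∩ D').Nonempty → U ∪ D ∪ D' ⊆ U ∪ C ∪ C' →
      D'.erase B ⊆ U := by
    intro D D' hD hD' hDD hBD hBD' hne1 hne2 hsub
    have h1 : D ∩ D' = {B} := by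
      by_contra hcon
      have e1 : (t : ℤ) ≤ excess t (D ∪ D') := hW _ ((Finset.union_subset_union_left
        Finset.subset_union_right).trans hsub) (by simp [hBD])
      have e2 := excess_union_add_inter_le t D D'
      have hB2 : B ∈ D ∩ D' := by simp [hBD, hBD']
      have hcard : 2 ≤ (D ∩ D').card := by
        by_contra hlt
        have hpos := Finset.card_pos.2 ⟨B, hB2⟩
        obtain ⟨x, hx⟩ := Finset.card_eq_one.1 (by omega : (D ∩ D').card = 1)
        rw [hx, Finset.mem_singleton] at hB2
        exact hcon (by rw [hx, hB2])
      have e3 := hD.2.2.1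
      have e4 := hD'.2.2.1
      rcases (Finset.inter_subset_left : D ∩ D' ⊆ D).eq_or_ssubset with h5 | h5
      · rcases (Finset.inter_eq_left.1 h5).eq_or_ssubset with h6 | h6
        · exact hDD h6
        · have := hD'.2.2.2 D h6 hD.1
          omega
      · have := hD.2.2.2 _ h5 hcard
        omega
    have h2 := hD.excess_union_le hU hne1
    have h3 : D' ⊆ U ∪ D := by
      by_contra hcon
      have hss : (U ∪ D) ∩ D' ⊂ D' := by
        refine Finset.inter_subset_right.ssubset_of_ne fun e => hcon ?_
        exact Finset.inter_eq_right.1 e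
      have hcard : 2 ≤ ((U ∪ D) ∩ D').card := by
        obtain ⟨x, hx⟩ := hne2
        rw [Finset.mem_inter] at hx
        rw [← Nat.lt_iff_add_one_le, Finset.one_lt_card]
        refine ⟨x, by simp [hx], B, by simp [hBD, hBD'], ?_⟩
        rintro rfl
        exact hBU hx.1
      have e1 := hD'.2.2.2 _ hss hcard
      have e2 := excess_union_add_inter_le t (U ∪ D) D'
      have e3 := hW _ hsub (by simp [hBD])
      have e4 := hD'.2.2.1
      omega
    intro x hx
    rw [Finset.mem_erase] at hx
    rcases Finset.mem_union.1 (h3 hx.2) with h4 | h4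
    · exact h4
    · have : x ∈ D ∩ D' := by simp [h4, hx.2]
      rw [h1, Finset.mem_singleton] at this
      exact absurd this hx.1
  have s1 := aux C C' hC hC' hne hB hB' h h' subset_rfl
  have s2 := aux C' C hC' hC hne.symm hB' hB h' h (by rw [Finset.union_right_comm])
  have s3 : (blockGraph B ∩ cover U).card ≤ t := by
    have e1 := hW (insert B U) (Finset.insert_subset (by simp [hB])
      (Finset.subset_union_left.trans Finset.subset_union_left)) (by simp)
    rw [excess_insert t hBU] at e1
    omega
  obtain ⟨b, -, hCb, hgb, hab⟩ := hC.eq_pair_of_inter hB s2 s3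
  obtain ⟨b', -, hCb', hgb', hab'⟩ := hC'.eq_pair_of_inter hB' s1 s3
  refine ⟨b, b', hCb, hCb', ?_, hab⟩
  have e := hgb.trans hgb'.symm
  ext v
  have := Finset.ext_iff.1 e (v, B v)
  simpa [mem_blockGraph, mem_agree, eq_comm] using this

end Blocks

/-! ### Counting configurations of blocks -/

section Counting

lemma exists_subset_image_fin {α : Type*} [DecidableEq α] [Nonempty α] {X : Finset α} {d : ℕ}
    (h : X.card ≤ d) : ∃ w : Fin d → α, X ⊆ univ.image w := by
  let e := X.equivFin
  refine ⟨fun i => if hi : i.1 < X.card then (e.symm ⟨i, hi⟩ : α) else Classical.arbitrary α, ?_⟩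
  intro x hx
  rw [Finset.mem_image]
  refine ⟨⟨e ⟨x, hx⟩, (e ⟨x, hx⟩).2.trans_le h⟩, Finset.mem_univ _, ?_⟩
  simp

variable {V : Type*} [DecidableEq V] [Fintype V] {N : ℕ}

lemma card_blocks_le {Y : Finset (V × Fin N)} {c : ℕ}
    (h : ∀ v, (univ.filter fun y => (v, y) ∈ Y).card ≤ c) :
    (univ.filter fun b : V → Fin N => blockGraph b ⊆ Y).card ≤ c ^ Fintype.card V := by
  have h1 : (univ.filter fun b : V → Fin N => blockGraph b ⊆ Y) ⊆
      Fintype.piFinset fun v => univ.filter fun y => (v, y) ∈ Y := by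
    intro b hb
    rw [Finset.mem_filter] at hb
    rw [Fintype.mem_piFinset]
    intro v
    simpa using hb.2 (mem_blockGraph.2 rfl : (v, b v) ∈ blockGraph b)
  refine (Finset.card_le_card h1).trans ?_
  rw [Fintype.card_piFinset]
  exact (Finset.prod_le_pow_card _ _ _ fun v _ => h v).trans (by rw [Finset.card_univ])

lemma card_cover_le_count [Nonempty V] (hN : 0 < N) (S : Finset (V → Fin N)) {s d : ℕ}
    (hs : S.card ≤ s) :
    (univ.filter fun U : Finset (V → Fin N) =>
      S ⊆ U ∧ (cover U).card ≤ (cover S).card + d).card ≤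
      (Fintype.card V * N) ^ d * 2 ^ (s + d) ^ Fintype.card V := by
  classical
  have : Nonempty (Fin N) := ⟨⟨0, hN⟩⟩
  have hsub : (univ.filter fun U : Finset (V → Fin N) =>
      S ⊆ U ∧ (cover U).card ≤ (cover S).card + d) ⊆
      (univ : Finset (Fin d → V × Fin N)).biUnion fun w =>
        (univ.filter fun b : V → Fin N => blockGraph b ⊆ cover S ∪ univ.image w).powerset := by
    intro U hU
    obtain ⟨-, hSU, hcard⟩ := Finset.mem_filter.1 hU
    have h1 : (cover U \ cover S).card ≤ d := by
      rw [Finset.card_sdiff_of_subset (cover_mono hSU)]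
      omega
    obtain ⟨w, hw⟩ := exists_subset_image_fin h1
    rw [Finset.mem_biUnion]
    refine ⟨w, Finset.mem_univ _, Finset.mem_powerset.2 fun b hb => ?_⟩
    rw [Finset.mem_filter]
    refine ⟨Finset.mem_univ _, (blockGraph_subset_cover hb).trans fun x hx => ?_⟩
    by_cases hxS : x ∈ cover S
    · exact Finset.mem_union_left _ hxS
    · exact Finset.mem_union_right _ (hw (Finset.mem_sdiff.2 ⟨hx, hxS⟩))
  refine (Finset.card_le_card hsub).trans (Finset.card_biUnion_le.trans ?_)
  refine (Finset.sum_le_card_nsmul _ _ (2 ^ (s + d) ^ Fintype.card V) fun w _ => ?_).trans ?_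
  · rw [Finset.card_powerset]
    refine Nat.pow_le_pow_right (by norm_num) (card_blocks_le fun v => ?_)
    have : (univ.filter fun y => (v, y) ∈ cover S ∪ univ.image w) ⊆
        S.image (fun b => b v) ∪ univ.image fun i => (w i).2 := by
      intro y hy
      simp only [Finset.mem_filter, Finset.mem_univ, true_and, Finset.mem_union, cover,
        Finset.mem_biUnion, mem_blockGraph, Finset.mem_image] at hy ⊢
      rcases hy with h | ⟨i, hi⟩
      · exact Or.inl h
      · exact Or.inr ⟨i, by rw [hi]⟩
    refine (Finset.card_le_card this).trans ((Finset.card_union_le _ _).trans ?_)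
    refine add_le_add (Finset.card_image_le.trans hs) (Finset.card_image_le.trans ?_)
    simp
  · simp [Finset.card_univ]

/-- The number of conflicts of size `s` through a block is at most this constant
times `N ^ ((|V| - t) (s - 1))`. -/
def conflictConst (m t s : ℕ) : ℕ :=
  m ^ ((m - t) * (s - 1)) * 2 ^ (1 + (m - t) * (s - 1)) ^ m

open Classical in
lemma card_conflict_le [Nonempty V] (hN : 0 < N) {t k s : ℕ} (ht : t < Fintype.card V)
    (B : V → Fin N) :
    (univ.filter fun C : Finset (V → Fin N) => Conflict t k C ∧ B ∈ C ∧ C.card = s).card ≤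
      conflictConst (Fintype.card V) t s * (N ^ (Fintype.card V - t)) ^ (s - 1) := by
  have h := card_cover_le_count hN {B} (s := 1) (d := (Fintype.card V - t) * (s - 1)) (by simp)
  rw [mul_pow, pow_mul N, mul_right_comm] at h
  refine le_trans (Finset.card_le_card fun C hC => ?_) h
  rw [Finset.mem_filter] at hC ⊢
  obtain ⟨-, hC, hB, hs⟩ := hC
  refine ⟨Finset.mem_univ _, by simpa using hB, ?_⟩
  rw [cover_singleton, card_blockGraph]
  have h1 := hC.2.2.1
  have h2 := hC.1
  unfold excess at h1
  obtain ⟨a, ha⟩ : ∃ a, s = a + 1 := ⟨s - 1, by omega⟩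
  obtain ⟨e, he⟩ : ∃ e, Fintype.card V = t + e := ⟨_, (Nat.add_sub_of_le ht.le).symm⟩
  rw [hs, ha, he] at h1
  rw [ha, he]
  simp only [Nat.add_sub_cancel, Nat.add_sub_cancel_left]
  push_cast at h1
  zify
  linarith

/-- The constant in the bound for the probability of atypically dense configurations. -/
noncomputable def rareConst (m t s K : ℕ) (c : ℝ) : ℝ :=
  ∑ a ∈ range (K + 1), c ^ a * ((m : ℝ) ^ (a * (m - t) - 1) * 2 ^ (s + (a * (m - t) - 1)) ^ m)

lemma rareConst_nonneg (m t s K : ℕ) {c : ℝ} (hc : 0 ≤ c) : 0 ≤ rareConst m t s K c := by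
  unfold rareConst
  positivity

open Classical in
lemma sum_rare_le [Nonempty V] (hN : 0 < N) {t s K : ℕ} (ht : t < Fintype.card V)
    (S : Finset (V → Fin N)) (hs : S.card ≤ s) {q c : ℝ} (hq : 0 ≤ q)
    (hqc : q * (N : ℝ) ^ (Fintype.card V - t) ≤ c) :
    ∑ U ∈ univ.filter (fun U : Finset (V → Fin N) => S ⊆ U ∧ U.card ≤ K ∧
      excess t U < excess t S), q ^ (U \ S).card ≤ rareConst (Fintype.card V) t s K c / N := by
  set m := Fintype.card V with hm
  have hc : 0 ≤ c := le_trans (by positivity) hqc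
  have hNR : (0 : ℝ) < N := by exact_mod_cast hN
  rw [rareConst, Finset.sum_div]
  rw [← Finset.sum_fiberwise_of_maps_to (t := range (K + 1)) (g := fun U => (U \ S).card)]
  · refine Finset.sum_le_sum fun a _ => ?_
    set T := (univ.filter (fun U : Finset (V → Fin N) => S ⊆ U ∧ U.card ≤ K ∧
      excess t U < excess t S)).filter fun U => (U \ S).card = a with hT
    have hkey : ∀ U ∈ T, 1 ≤ a * (m - t) ∧
        (S ⊆ U ∧ (cover U).card ≤ (cover S).card + (a * (m - t) - 1)) := by
      intro U hU
      simp only [hT, Finset.mem_filter, Finset.mem_univ, true_and] at hU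
      obtain ⟨⟨hSU, -, hex⟩, ha⟩ := hU
      have h1 := Finset.card_le_card (cover_mono hSU)
      have h2 := Finset.card_sdiff_add_card_eq_card hSU
      rw [ha] at h2
      unfold excess at hex
      obtain ⟨e, he⟩ : ∃ e, m = t + e := ⟨_, (Nat.add_sub_of_le ht.le).symm⟩
      rw [← hm, ← h2, he] at hex
      rw [he, Nat.add_sub_cancel_left]
      push_cast at hex
      have h3 : ((cover U).card : ℤ) < (cover S).card + a * e := by linarith
      have h4 : (cover U).card < (cover S).card + a * e := by exact_mod_cast h3
      exact ⟨by omega, hSU, by omega⟩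
    by_cases hTe : T = ∅
    · rw [hTe, Finset.sum_empty]
      positivity
    · obtain ⟨U₀, hU₀⟩ := Finset.nonempty_iff_ne_empty.2 hTe
      have ha1 := (hkey U₀ hU₀).1
      have hcard : (T.card : ℝ) ≤ (m * N : ℝ) ^ (a * (m - t) - 1) *
          2 ^ (s + (a * (m - t) - 1)) ^ m := by
        have h := card_cover_le_count hN S (d := a * (m - t) - 1) hs
        have h' := (Finset.card_le_card fun U hU => by
          rw [Finset.mem_filter]
          exact ⟨Finset.mem_univ _, (hkey U hU).2⟩ : T.card ≤ _).trans h
        exact_mod_cast h'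
      have hsum : ∑ U ∈ T, q ^ (U \ S).card = T.card * q ^ a := by
        rw [Finset.sum_congr rfl fun U hU => by rw [(Finset.mem_filter.1 hU).2],
          Finset.sum_const, nsmul_eq_mul]
      rw [hsum, le_div_iff₀ hNR]
      have hpow : (N : ℝ) ^ (a * (m - t) - 1) * N = (N ^ (m - t)) ^ a := by
        rw [← pow_succ, Nat.sub_add_cancel ha1, mul_comm a, pow_mul]
      calc (T.card : ℝ) * q ^ a * N
          ≤ ((m * N : ℝ) ^ (a * (m - t) - 1) * 2 ^ (s + (a * (m - t) - 1)) ^ m) * q ^ a * N := by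
            gcongr
        _ = (q * N ^ (m - t)) ^ a *
            ((m : ℝ) ^ (a * (m - t) - 1) * 2 ^ (s + (a * (m - t) - 1)) ^ m) := by
            rw [mul_pow q, ← hpow, mul_pow]; ring
        _ ≤ _ := by gcongr
  · intro U hU
    rw [Finset.mem_filter] at hU
    rw [Finset.mem_range]
    have := Finset.card_le_card (Finset.sdiff_subset : U \ S ⊆ U)
    omega

lemma prob_rare_le [Nonempty V] (hN : 0 < N) {t s K : ℕ} (ht : t < Fintype.card V)
    {R : Type*} [Fintype R] [Nonempty R] (S : Finset (V → Fin N)) (hs : S.card ≤ s)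
    (L Op : R → Prop) {c : ℝ} (hqc : prob Op * (N : ℝ) ^ (Fintype.card V - t) ≤ c) :
    prob (fun ω : (V → Fin N) → R => (∀ b ∈ S, L (ω b)) ∧
      ∃ U, S ⊆ U ∧ U.card ≤ K ∧ excess t U < excess t S ∧ ∀ b ∈ U, b ∉ S → Op (ω b)) ≤
      prob L ^ S.card * (rareConst (Fintype.card V) t s K c / N) := by
  classical
  set T := univ.filter (fun U : Finset (V → Fin N) => S ⊆ U ∧ U.card ≤ K ∧
      excess t U < excess t S) with hT
  calc _ ≤ prob (fun ω : (V → Fin N) → R => ∃ U ∈ T, ∀ b ∈ U,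
          if b ∈ S then L (ω b) else Op (ω b)) := by
        refine prob_mono fun ω ⟨h1, U, h2, h3, h4, h5⟩ => ⟨U, by simp [hT, h2, h3, h4], ?_⟩
        intro b hb
        split_ifs with hbS
        · exact h1 b hbS
        · exact h5 b hb hbS
    _ ≤ ∑ U ∈ T, prob (fun ω : (V → Fin N) → R => ∀ b ∈ U,
          if b ∈ S then L (ω b) else Op (ω b)) := prob_exists_le _ _
    _ = ∑ U ∈ T, prob L ^ S.card * prob Op ^ (U \ S).card := by
        refine Finset.sum_congr rfl fun U hU => ?_
        have hSU : S ⊆ U := (Finset.mem_filter.1 hU).2.1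
        rw [prob_forall_mem U fun b r => if b ∈ S then L r else Op r,
          ← Finset.prod_sdiff hSU, mul_comm]
        congr 1
        · exact Finset.prod_eq_pow_card fun b hb => by simp only [hb, if_true]
        · exact Finset.prod_eq_pow_card fun b hb => by
            simp only [(Finset.mem_sdiff.1 hb).2, if_false]
    _ ≤ _ := by
        rw [← Finset.mul_sum]
        exact mul_le_mul_of_nonneg_left (sum_rare_le hN ht S hs (prob_nonneg _) hqc)
          (pow_nonneg (prob_nonneg _) _)

end Counting

/-! ### The probability of being accepted -/

section AcceptProb

variable {V : Type*} [DecidableEq V] [Fintype V] {N : ℕ}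

lemma excess_map_piCongrRight (t : ℕ) (σ : V → Equiv.Perm (Fin N)) (C : Finset (V → Fin N)) :
    excess t (C.map (Equiv.piCongrRight σ).toEmbedding) = excess t C := by
  have h : cover (C.map (Equiv.piCongrRight σ).toEmbedding) =
      (cover C).image fun x => (x.1, σ x.1 x.2) := by
    ext ⟨v, y⟩
    simp only [cover, Finset.mem_biUnion, Finset.mem_map, mem_blockGraph, Finset.mem_image,
      Prod.exists, Prod.mk.injEq, Equiv.coe_toEmbedding]
    constructor
    · rintro ⟨_, ⟨b, hb, rfl⟩, h⟩
      exact ⟨v, b v, ⟨b, hb, rfl⟩, rfl, h⟩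
    · rintro ⟨_, _, ⟨b, hb, rfl⟩, rfl, h⟩
      exact ⟨_, ⟨b, hb, rfl⟩, h⟩
  have hinj : Function.Injective fun x : V × Fin N => (x.1, σ x.1 x.2) := by
    rintro ⟨v, y⟩ ⟨w, z⟩ h
    simp only [Prod.mk.injEq] at h
    obtain ⟨rfl, h⟩ := h
    rw [(σ v).injective h]
  rw [excess, excess, Finset.card_map, h, Finset.card_image_of_injective _ hinj]

lemma Conflict.map_piCongrRight {t k : ℕ} {C : Finset (V → Fin N)} (hC : Conflict t k C)
    (σ : V → Equiv.Perm (Fin N)) :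
    Conflict t k (C.map (Equiv.piCongrRight σ).toEmbedding) := by
  obtain ⟨h1, h2, h3, h4⟩ := hC
  refine ⟨by simpa using h1, by simpa using h2, by rwa [excess_map_piCongrRight], ?_⟩
  intro S hS h2
  obtain ⟨S', -, rfl⟩ := Finset.subset_map_iff.1 hS.1
  rw [excess_map_piCongrRight]
  exact h4 S' (Finset.map_ssubset_map.1 hS) (by simpa using h2)

lemma conflict_map_piCongrRight {t k : ℕ} (σ : V → Equiv.Perm (Fin N))
    (C : Finset (V → Fin N)) :
    Conflict t k (C.map (Equiv.piCongrRight σ).toEmbedding) ↔ Conflict t k C := by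
  refine ⟨fun h => ?_, fun h => h.map_piCongrRight σ⟩
  have := h.map_piCongrRight fun v => (σ v).symm
  rw [Finset.map_map] at this
  convert this
  ext b
  simp only [Finset.mem_map, Function.Embedding.trans_apply, Equiv.coe_toEmbedding]
  constructor
  · intro hb; exact ⟨b, hb, by ext; simp⟩
  · rintro ⟨b', hb', rfl⟩
    convert hb'
    ext; simp

/-- The probability that a block is accepted during the first `j` rounds when all blocks are
given independent uniform labels below `Q`. -/
noncomputable def acceptProb (t k Q j : ℕ) (b : V → Fin N) : ℝ :=
  prob fun ω : (V → Fin N) → Fin Q => b ∈ accepted (Conflict t k) (fun x => (ω x : ℕ)) j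

lemma acceptProb_eq (t k Q j : ℕ) (b b' : V → Fin N) :
    acceptProb t k Q j b = acceptProb t k Q j b' := by
  set τ : (V → Fin N) ≃ (V → Fin N) :=
    Equiv.piCongrRight fun v => Equiv.swap (b v) (b' v) with hτ
  have hb : τ b = b' := by ext v; simp [hτ]
  unfold acceptProb
  rw [← hb, ← prob_comp_equiv (Equiv.arrowCongr τ.symm (Equiv.refl (Fin Q)))]
  congr 1
  funext ω
  rw [eq_iff_iff, accepted_comp_equiv τ (conflict_map_piCongrRight _)]
  rfl

lemma acceptProb_mono (t k Q : ℕ) (b : V → Fin N) :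
    Monotone fun j => acceptProb t k Q j b :=
  fun _ _ hj => prob_mono fun _ h => accepted_mono hj h

/-- The blocks that agree with `B` on `T`. -/
def agreeing (T : Finset V) (B : V → Fin N) : Finset (V → Fin N) :=
  Fintype.piFinset fun v => if v ∈ T then {B v} else univ

lemma mem_agreeing {T : Finset V} {B b : V → Fin N} :
    b ∈ agreeing T B ↔ ∀ v ∈ T, b v = B v := by
  rw [agreeing, Fintype.mem_piFinset]
  refine forall_congr' fun v => ?_
  split_ifs with h <;> simp [h]

lemma card_agreeing (T : Finset V) (B : V → Fin N) :
    (agreeing T B).card = N ^ (Fintype.card V - T.card) := by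
  rw [agreeing, Fintype.card_piFinset, ← Finset.card_compl,
    ← Finset.prod_subset (Finset.subset_univ Tᶜ)]
  · refine (Finset.prod_eq_pow_card (b := N) fun v hv => ?_)
    rw [if_neg (Finset.mem_compl.1 hv), Finset.card_univ, Fintype.card_fin]
  · intro v _ hv
    rw [if_pos (by simpa using hv), Finset.card_singleton]

lemma lt_excess_of_subset_accepted {t k j : ℕ} {ω : (V → Fin N) → ℕ} {S : Finset (V → Fin N)}
    (hS : ∀ b ∈ S, b ∈ accepted (Conflict t k) ω j) (h2 : 2 ≤ S.card) (hk : S.card ≤ k) :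
    t < excess t S := by
  by_contra! hcon
  obtain ⟨C, hCS, hC⟩ := Conflict.exists_subset h2 hk hcon
  exact not_subset_accepted hC (Finset.card_pos.1 (by have := hC.1; omega)) j
    fun b hb => hS b (hCS hb)

lemma pow_mul_acceptProb_le_one {t k : ℕ} (hk : 2 ≤ k) (ht : t ≤ Fintype.card V) (Q j : ℕ)
    (B : V → Fin N) : (N : ℝ) ^ (Fintype.card V - t) * acceptProb t k Q j B ≤ 1 := by
  obtain ⟨T, -, hT⟩ := Finset.exists_subset_card_eq (s := (univ : Finset V)) (n := t)
    (by rwa [Finset.card_univ])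
  have h := sum_prob_le_one (Ω := (V → Fin N) → Fin Q) (agreeing T B)
    (fun b ω => b ∈ accepted (Conflict t k) (fun x => (ω x : ℕ)) j) (by
      intro b hb b' hb' hne ω h1 h2
      have h3 := lt_excess_of_subset_accepted (S := {b, b'}) (by
        intro x hx
        simp only [Finset.mem_insert, Finset.mem_singleton] at hx
        rcases hx with rfl | rfl <;> assumption) (by rw [Finset.card_pair hne])
        (by rw [Finset.card_pair hne]; exact hk)
      rw [excess_pair t hne, ← card_agree] at h3
      have h4 : T ⊆ agree b b' := fun v hv => mem_agree.2
        ((mem_agreeing.1 hb v hv).trans (mem_agreeing.1 hb' v hv).symm)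
      have := Finset.card_le_card h4
      omega)
  have h' : ∀ b ∈ agreeing T B, prob (fun ω : (V → Fin N) → Fin Q =>
      b ∈ accepted (Conflict t k) (fun x => (ω x : ℕ)) j) = acceptProb t k Q j B :=
    fun b _ => acceptProb_eq t k Q j b B
  rw [Finset.sum_congr rfl h', Finset.sum_const, card_agreeing, hT, nsmul_eq_mul] at h
  exact_mod_cast h

lemma prob_forall_accepted_le [Nonempty V] (hN : 0 < N) {t k Q j J : ℕ} [NeZero Q]
    (ht : t < Fintype.card V) (hj : j ≤ J) {S : Finset (V → Fin N)} (hSk : S.card ≤ k)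
    (hS : S.Nonempty) (hST : ∀ S' ⊆ S, 2 ≤ S'.card → t < excess t S') (B : V → Fin N) {c : ℝ}
    (hc : k * prob (fun x : Fin Q => (x : ℕ) < J) * (N : ℝ) ^ (Fintype.card V - t) ≤ c) :
    prob (fun ω : (V → Fin N) → Fin Q =>
      ∀ b ∈ S, b ∈ accepted (Conflict t k) (fun x => (ω x : ℕ)) j) ≤
      acceptProb t k Q j B ^ S.card + prob (fun x : Fin Q => (x : ℕ) < J) ^ S.card *
        (rareConst (Fintype.card V) t k (2 * (1 + J * k) + k) c / N) := by
  classical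
  obtain ⟨b₀, hb₀⟩ := hS
  set Cf : Finset (V → Fin N) → Prop := Conflict t k with hCf
  set P : Fin Q → Prop := fun x => (x : ℕ) < J with hP
  set g₀ : S := ⟨b₀, hb₀⟩ with hg₀
  set f : S → ((V → Fin N) → Fin Q) → Prop := fun b ω =>
    (b : V → Fin N) ∈ accepted Cf (fun x => (ω x : ℕ)) j with hf
  set Z : S → Set (V → Fin N) → Set (V → Fin N) := fun b O => reach Cf O j b with hZ
  set Good : Set (V → Fin N) → Prop := fun O => ∀ g g' z, z ∈ Z g O → z ∈ Z g' O → g = g'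
    with hGood
  have hdec := prob_decouple g₀ P Z f Good
    (fun g O ω ω' hO hO' h => mem_accepted_of_agree hO hO' hj fun z hz => by rw [h z hz])
    (fun O h => h)
  have hmarg : prob (fun ω : (V → Fin N) → Fin Q =>
      ∀ b ∈ S, b ∈ accepted Cf (fun x => (ω x : ℕ)) j) =
      prob (fun ω : (V → Fin N) → S → Fin Q => ∀ g, f g fun b => ω b g₀) := by
    rw [prob_marginal g₀ fun ω => ∀ g, f g ω]
    simp [hf]
  have hsplit : prob (fun ω : (V → Fin N) → S → Fin Q => ∀ g, f g fun b => ω b g₀) ≤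
      prob (fun ω : (V → Fin N) → S → Fin Q => Good {b | ∃ g, P (ω b g)} ∧
        ∀ g, f g fun b => ω b g₀) +
      prob (fun ω : (V → Fin N) → S → Fin Q => ¬ Good {b | ∃ g, P (ω b g)} ∧
        ∀ g, f g fun b => ω b g₀) := by
    refine le_trans (prob_mono fun ω h => ?_) (prob_or_le _ _)
    by_cases hG : Good {b | ∃ g, P (ω b g)}
    · exact Or.inl ⟨hG, h⟩
    · exact Or.inr ⟨hG, h⟩
  have hfirst : prob (fun ω : (V → Fin N) → S → Fin Q => Good {b | ∃ g, P (ω b g)} ∧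
        ∀ g, f g fun b => ω b g₀) ≤ acceptProb t k Q j B ^ S.card := by
    rw [← hdec]
    refine (prob_mono fun ω h => h.2).trans (le_of_eq ?_)
    have hfb : ∀ b ∈ (univ : Finset S), prob (f b) = acceptProb t k Q j B :=
      fun b _ => acceptProb_eq t k Q j _ _
    rw [prob_independent, Finset.prod_eq_pow_card hfb]
    simp
  have hL : prob (fun x : S → Fin Q => P (x g₀)) = prob P := by
    have := prob_forall_mem (β := S) {g₀} fun _ => P
    simpa using this
  have hsecond : prob (fun ω : (V → Fin N) → S → Fin Q => ¬ Good {b | ∃ g, P (ω b g)} ∧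
        ∀ g, f g fun b => ω b g₀) ≤ prob P ^ S.card *
        (rareConst (Fintype.card V) t k (2 * (1 + J * k) + k) c / N) := by
    have hrare := prob_rare_le hN (s := k) (K := 2 * (1 + J * k) + k) ht S hSk
      (fun x : S → Fin Q => P (x g₀)) (fun x => ∃ g, P (x g)) (c := c) (by
        refine le_trans ?_ hc
        gcongr
        refine (prob_exists_coord_le P).trans ?_
        gcongr
        · exact prob_nonneg _
        · simpa using hSk)
    rw [hL] at hrare
    refine le_trans (prob_mono fun ω h => ?_) hrare
    obtain ⟨hG, hacc⟩ := h
    refine ⟨fun b hb => (label_lt_of_mem_accepted (hacc ⟨b, hb⟩)).trans_le hj, ?_⟩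
    simp only [hGood, not_forall] at hG
    obtain ⟨⟨b, hb⟩, ⟨b', hb'⟩, z, hz, hz', hne⟩ := hG
    have hcard : ∀ C, Cf C → C.card ≤ k := fun C hC => hC.2.1
    obtain ⟨U, hU, hbU, hzU, hUO, hUc⟩ := exists_linked_of_mem_reach hcard hz
    obtain ⟨U', hU', hbU', hzU', hUO', hUc'⟩ := exists_linked_of_mem_reach hcard hz'
    have hlink := (hU.union hU' ⟨z, Finset.mem_inter.2 ⟨hzU, hzU'⟩⟩).excess_le
    have hjk : j * k ≤ J * k := Nat.mul_le_mul_right k hj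
    refine ⟨U ∪ U' ∪ S, Finset.subset_union_right, ?_, ?_, ?_⟩
    · have := Finset.card_union_le U U'
      have := Finset.card_union_le (U ∪ U') S
      omega
    · have h1 := excess_union_add_inter_le t (U ∪ U') S
      have h2 := hST ((U ∪ U') ∩ S) Finset.inter_subset_right (by
        rw [← Nat.lt_iff_add_one_le, Finset.one_lt_card]
        exact ⟨b, by simp [hbU, hb], b', by simp [hbU', hb'], fun e => hne (by simp [e])⟩)
      omega
    · intro x hx hxS
      rcases Finset.mem_union.1 hx with hx | hx
      · rcases Finset.mem_union.1 hx with hx | hx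
        · exact hUO x hx fun e => hxS (by rw [e]; exact hb)
        · exact hUO' x hx fun e => hxS (by rw [e]; exact hb')
      · exact absurd hx hxS
  rw [hmarg]
  exact hsplit.trans (add_le_add hfirst hsecond)

end AcceptProb

/-! ### The probability of being available -/

section Available

variable {V : Type*} [DecidableEq V] [Fintype V] {N : ℕ}

/-- No conflict through `B` that satisfies `G` is completed by `B` after `j` rounds, where the label
of `B` itself is replaced by the inactive label `J`. -/
def AvailableFor (t k J j : ℕ) (B : V → Fin N) (G : Finset (V → Fin N) → Prop)
    (ω : (V → Fin N) → ℕ) : Prop :=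
  ∀ C, G C → Conflict t k C → B ∈ C →
    ∃ b ∈ C, b ≠ B ∧ b ∉ accepted (Conflict t k) (Function.update ω B J) j

lemma AvailableFor.of_agree {t k J j : ℕ} (hj : j ≤ J) {B : V → Fin N}
    {G : Finset (V → Fin N) → Prop} {ω ω' : (V → Fin N) → ℕ} {O : Set (V → Fin N)}
    (hO : ∀ b, ω b < J → b ∈ O) (hO' : ∀ b, ω' b < J → b ∈ O)
    (h : ∀ C, G C → Conflict t k C → B ∈ C → (∀ x ∈ C, x ≠ B → x ∈ O) →
      ∀ b ∈ C, b ≠ B → ∀ z ∈ reach (Conflict t k) (O \ {B}) j b, ω z = ω' z)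
    (hav : AvailableFor t k J j B G ω) : AvailableFor t k J j B G ω' := by
  intro C hG hC hB
  by_contra! hcon
  have hupd : ∀ τ : (V → Fin N) → ℕ, (∀ b, τ b < J → b ∈ O) →
      ∀ b, Function.update τ B J b < J → b ∈ O \ {B} := by
    intro τ hτ b hb
    by_cases e : b = B
    · subst e; simp at hb
    · rw [Function.update_of_ne e] at hb
      exact ⟨hτ b hb, e⟩
  obtain ⟨b, hb, hbB, hna⟩ := hav C hG hC hB
  refine hna ?_
  rw [mem_accepted_of_agree (hupd ω hO) (hupd ω' hO') hj]
  · exact hcon b hb hbB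
  · intro z hz
    by_cases e : z = B
    · subst e; simp
    · rw [Function.update_of_ne e, Function.update_of_ne e]
      refine h C hG hC hB (fun x hx hxB => ?_) b hb hbB z hz
      have := label_lt_of_mem_accepted (hcon x hx hxB)
      exact (hupd ω' hO' x (this.trans_le hj)).1

lemma prod_prob_availableFor_le [Nonempty V] (hN : 0 < N) {t k Q j J : ℕ} [NeZero Q]
    (ht : t < Fintype.card V) (hj : j ≤ J) (B : V → Fin N) {ι : Type*} [Fintype ι] [Nonempty ι]
    (G : ι → Finset (V → Fin N) → Prop) (hcov : ∀ C, Conflict t k C → B ∈ C → ∃ g, G g C)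
    (hsep : ∀ g g' C C', G g C → G g' C' → Conflict t k C → Conflict t k C' → B ∈ C → B ∈ C' →
      (∀ W ⊆ C, B ∈ W → (t : ℤ) ≤ excess t W) → (C ≠ C' → ∃ b b', C = {B, b} ∧ C' = {B, b'} ∧
        agree B b = agree B b' ∧ (agree B b).card = t) → g = g') {c : ℝ}
    (hc : Fintype.card ι * prob (fun x : Fin Q => (x : ℕ) < J) *
      (N : ℝ) ^ (Fintype.card V - t) ≤ c) :
    ∏ g, prob (fun ω : (V → Fin N) → Fin Q =>
        AvailableFor t k J j B (G g) fun x => (ω x : ℕ)) -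
      rareConst (Fintype.card V) t 1 (2 * (1 + J * k) + 2 * k) c / N ≤
    prob (fun ω : (V → Fin N) → Fin Q =>
      AvailableFor t k J j B (fun _ => True) fun x => (ω x : ℕ)) := by
  classical
  set Cf : Finset (V → Fin N) → Prop := Conflict t k with hCf
  set P : Fin Q → Prop := fun x => (x : ℕ) < J with hP
  set g₀ : ι := Classical.arbitrary ι
  set f : ι → ((V → Fin N) → Fin Q) → Prop := fun g ω =>
    AvailableFor t k J j B (G g) fun x => (ω x : ℕ) with hf
  set Z : ι → Set (V → Fin N) → Set (V → Fin N) := fun g O => {z | ∃ C, G g C ∧ Cf C ∧ B ∈ C ∧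
    (∀ x ∈ C, x ≠ B → x ∈ O) ∧ ∃ b ∈ C, b ≠ B ∧ z ∈ reach Cf (O \ {B}) j b} with hZ
  set Good : Set (V → Fin N) → Prop := fun O => ∀ g g' z, z ∈ Z g O → z ∈ Z g' O → g = g'
    with hGood
  have hdec := prob_decouple g₀ P Z f Good
    (fun g O ω ω' hO hO' h => by
      have h' : ∀ C, G g C → Cf C → B ∈ C → (∀ x ∈ C, x ≠ B → x ∈ O) →
          ∀ b ∈ C, b ≠ B → ∀ z ∈ reach Cf (O \ {B}) j b, ω z = ω' z :=
        fun C h1 h2 h3 h4 b h5 h6 z hz => h z ⟨C, h1, h2, h3, h4, b, h5, h6, hz⟩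
      constructor
      · exact AvailableFor.of_agree hj hO hO' fun C h1 h2 h3 h4 b h5 h6 z hz => by
          rw [h' C h1 h2 h3 h4 b h5 h6 z hz]
      · exact AvailableFor.of_agree hj hO' hO fun C h1 h2 h3 h4 b h5 h6 z hz => by
          rw [h' C h1 h2 h3 h4 b h5 h6 z hz])
    (fun O h => h)
  have hmarg : prob (fun ω : (V → Fin N) → ι → Fin Q => ∀ g, f g fun b => ω b g₀) ≤
      prob (fun ω : (V → Fin N) → Fin Q =>
        AvailableFor t k J j B (fun _ => True) fun x => (ω x : ℕ)) := by
    rw [prob_marginal g₀ fun ω => ∀ g, f g ω]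
    refine prob_mono fun ω h C _ hC hB => ?_
    obtain ⟨g, hg⟩ := hcov C hC hB
    exact h g C hg hC hB
  have hsplit : prob (fun ω : (V → Fin N) → ι → Fin Q => ∀ g, f g fun b => ω b g) ≤
      prob (fun ω : (V → Fin N) → ι → Fin Q => Good {b | ∃ g, P (ω b g)} ∧
        ∀ g, f g fun b => ω b g) +
      prob (fun ω : (V → Fin N) → ι → Fin Q => ¬ Good {b | ∃ g, P (ω b g)}) := by
    refine le_trans (prob_mono fun ω h => ?_) (prob_or_le _ _)
    by_cases hG : Good {b | ∃ g, P (ω b g)}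
    · exact Or.inl ⟨hG, h⟩
    · exact Or.inr hG
  have hbad : prob (fun ω : (V → Fin N) → ι → Fin Q => ¬ Good {b | ∃ g, P (ω b g)}) ≤
      rareConst (Fintype.card V) t 1 (2 * (1 + J * k) + 2 * k) c / N := by
    have hrare := prob_rare_le hN (s := 1) (K := 2 * (1 + J * k) + 2 * k) ht {B} (by simp)
      (fun _ : ι → Fin Q => True) (fun x => ∃ g, P (x g)) (c := c) (by
        refine le_trans ?_ hc
        gcongr
        exact prob_exists_coord_le P)
    rw [prob_true, one_pow, one_mul] at hrare
    refine le_trans (prob_mono fun ω hG => ?_) hrare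
    set O : Set (V → Fin N) := {b | ∃ g, P (ω b g)} with hO
    simp only [hGood, not_forall] at hG
    obtain ⟨g, g', z, ⟨C, hg, hC, hB, hCO, b, hb, hbB, hz⟩,
      ⟨C', hg', hC', hB', hCO', b', hb', hbB', hz'⟩, hne⟩ := hG
    refine ⟨fun _ _ => trivial, ?_⟩
    have hcard : ∀ C, Cf C → C.card ≤ k := fun C hC => hC.2.1
    obtain ⟨U, hU, hbU, hzU, hUO, hUc⟩ := exists_linked_of_mem_reach hcard hz
    obtain ⟨U', hU', hbU', hzU', hUO', hUc'⟩ := exists_linked_of_mem_reach hcard hz'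
    have hlink := (hU.union hU' ⟨z, Finset.mem_inter.2 ⟨hzU, hzU'⟩⟩).excess_le
    have hjk : j * k ≤ J * k := Nat.mul_le_mul_right k hj
    have hUO2 : ∀ x ∈ U ∪ U', x ∈ O \ {B} := by
      intro x hx
      rcases Finset.mem_union.1 hx with hx | hx
      · by_cases e : x = b
        · subst e; exact ⟨hCO x hb hbB, hbB⟩
        · exact hUO x hx e
      · by_cases e : x = b'
        · subst e; exact ⟨hCO' x hb' hbB', hbB'⟩
        · exact hUO' x hx e
    have hexW : ∃ W ⊆ U ∪ U' ∪ C ∪ C', B ∈ W ∧ excess t W < t := by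
      by_contra! hcon
      refine hne (hsep g g' C C' hg hg' hC hC' hB hB'
        (fun W hW => hcon W (hW.trans (Finset.subset_union_right.trans
          Finset.subset_union_left))) fun hCC => ?_)
      exact hC.agree_eq_of_meet hC' hCC hB hB' hlink (fun h => (hUO2 B h).2 rfl)
        ⟨b, by simp [hbU, hb]⟩ ⟨b', by simp [hbU', hb']⟩ hcon
    obtain ⟨W, hW, hBW, hex⟩ := hexW
    refine ⟨W, by simpa using hBW, ?_, by rwa [excess_singleton], ?_⟩
    · have h1 := Finset.card_le_card hW
      have := Finset.card_union_le U U'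
      have := Finset.card_union_le (U ∪ U') C
      have := Finset.card_union_le (U ∪ U' ∪ C) C'
      have := hcard C hC
      have := hcard C' hC'
      omega
    · intro x hx hxB
      rw [Finset.mem_singleton] at hxB
      rcases Finset.mem_union.1 (hW hx) with hx | hx
      · rcases Finset.mem_union.1 hx with hx | hx
        · exact (hUO2 x hx).1
        · exact hCO x hx hxB
      · exact hCO' x hx hxB
  rw [← prob_independent]
  linarith [hdec, hmarg, hsplit, hbad, prob_mono (Ω := (V → Fin N) → ι → Fin Q)
    (E := fun ω => Good {b | ∃ g, P (ω b g)} ∧ ∀ g, f g fun b => ω b g₀)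
    (E' := fun ω => ∀ g, f g fun b => ω b g₀) fun ω h => h.2]

end Available

section AvailableBound

lemma exists_coloring {α : Type*} [DecidableEq α] (s : Finset α) (w : α → ℝ)
    (hw : ∀ a ∈ s, w a ≤ 1 / 4) (hw0 : ∀ a ∈ s, 0 ≤ w a) {L : ℕ} (hL : 0 < L)
    (hs : ∑ a ∈ s, w a ≤ L / 4) :
    ∃ col : α → Fin L, ∀ l, ∑ a ∈ s with col a = l, w a ≤ 1 / 2 := by
  induction s using Finset.induction_on with
  | empty => exact ⟨fun _ => ⟨0, hL⟩, by simp⟩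
  | insert a s ha ih =>
    rw [Finset.sum_insert ha] at hs
    have ha0 := hw0 a (Finset.mem_insert_self _ _)
    obtain ⟨col, hcol⟩ := ih (fun b hb => hw b (Finset.mem_insert_of_mem hb))
      (fun b hb => hw0 b (Finset.mem_insert_of_mem hb)) (by linarith)
    obtain ⟨l, hl⟩ : ∃ l, ∑ b ∈ s with col b = l, w b ≤ 1 / 4 := by
      by_contra! hcon
      have : Nonempty (Fin L) := ⟨⟨0, hL⟩⟩
      have h1 := Finset.sum_lt_sum_of_nonempty (s := (univ : Finset (Fin L))) univ_nonempty
        fun l _ => hcon l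
      rw [Finset.sum_fiberwise] at h1
      simp only [Finset.sum_const, Finset.card_univ, Fintype.card_fin, nsmul_eq_mul] at h1
      linarith
    refine ⟨Function.update col a l, fun l' => ?_⟩
    have hcongr : (s.filter fun b => Function.update col a l b = l') =
        s.filter fun b => col b = l' := by
      refine Finset.filter_congr fun b hb => ?_
      rw [Function.update_of_ne]
      rintro rfl
      exact ha hb
    rw [Finset.filter_insert, Function.update_self, hcongr]
    split_ifs with h
    · subst h
      rw [Finset.sum_insert (by simp [ha])]
      have := hw a (Finset.mem_insert_self _ _)
      linarith
    · exact hcol l'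

variable {V : Type*} [DecidableEq V] [Fintype V] {N : ℕ}

lemma prob_label_lt (Q J : ℕ) [NeZero Q] (B : V → Fin N) :
    prob (fun ω : (V → Fin N) → Fin Q => (ω B : ℕ) < J) =
      prob fun x : Fin Q => (x : ℕ) < J := by
  simpa using prob_forall_mem {B} fun _ (x : Fin Q) => (x : ℕ) < J

lemma le_prob_availableFor {t k Q j J : ℕ} [NeZero Q] (hj : j ≤ J) (B : V → Fin N)
    (G : Finset (V → Fin N) → Prop) :
    1 - prob (fun x : Fin Q => (x : ℕ) < J) - prob (fun ω : (V → Fin N) → Fin Q =>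
      ∃ C, G C ∧ Conflict t k C ∧ B ∈ C ∧
        ∀ b ∈ C.erase B, b ∈ accepted (Conflict t k) (fun x => (ω x : ℕ)) j) ≤
    prob fun ω : (V → Fin N) → Fin Q => AvailableFor t k J j B G fun x => (ω x : ℕ) := by
  have h1 := prob_add_prob_not fun ω : (V → Fin N) → Fin Q =>
    AvailableFor t k J j B G fun x => (ω x : ℕ)
  have h2 : prob (fun ω : (V → Fin N) → Fin Q => ¬ AvailableFor t k J j B G fun x => (ω x : ℕ)) ≤
      prob (fun ω : (V → Fin N) → Fin Q => (ω B : ℕ) < J) +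
      prob (fun ω : (V → Fin N) → Fin Q => ∃ C, G C ∧ Conflict t k C ∧ B ∈ C ∧
        ∀ b ∈ C.erase B, b ∈ accepted (Conflict t k) (fun x => (ω x : ℕ)) j) := by
    refine (prob_mono fun ω h => ?_).trans (prob_or_le _ _)
    by_cases hlt : (ω B : ℕ) < J
    · exact Or.inl hlt
    · right
      unfold AvailableFor at h
      push Not at h
      obtain ⟨C, hG, hC, hB, hacc⟩ := h
      refine ⟨C, hG, hC, hB, fun b hb => ?_⟩
      rw [Finset.mem_erase] at hb
      rw [← accepted_update_of_le (B := B) hj (hj.trans (not_lt.1 hlt))]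
      exact hacc b hb.2 hb.1
  rw [prob_label_lt] at h2
  linarith

lemma le_prob_availableFor_pair {t k Q j J : ℕ} [NeZero Q] (hj : j ≤ J) (B : V → Fin N)
    {T : Finset V} (hT : T.card = t) :
    1 - prob (fun x : Fin Q => (x : ℕ) < J) -
      (N : ℝ) ^ (Fintype.card V - t) * acceptProb t k Q j B ≤
    prob fun ω : (V → Fin N) → Fin Q => AvailableFor t k J j B
      (fun C => ∃ b, b ≠ B ∧ C = {B, b} ∧ T ⊆ agree B b) fun x => (ω x : ℕ) := by
  refine le_trans ?_ (le_prob_availableFor hj B _)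
  gcongr
  calc _ ≤ prob (fun ω : (V → Fin N) → Fin Q => ∃ b ∈ agreeing T B,
        b ∈ accepted (Conflict t k) (fun x => (ω x : ℕ)) j) := by
        refine prob_mono fun ω h => ?_
        obtain ⟨C, ⟨b, hbB, rfl, hTb⟩, -, -, hacc⟩ := h
        refine ⟨b, mem_agreeing.2 fun v hv => (mem_agree.1 (hTb hv)).symm, hacc b ?_⟩
        simp [hbB]
    _ ≤ ∑ b ∈ agreeing T B, acceptProb t k Q j b := prob_exists_le _ _
    _ = _ := by
        rw [Finset.sum_congr rfl fun b _ => acceptProb_eq t k Q j b B, Finset.sum_const,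
          card_agreeing, hT, nsmul_eq_mul]
        push_cast
        rfl

open Classical in
/-- The conflicts through `B` that consist of at least three blocks. -/
noncomputable def bigConflicts (t k : ℕ) (B : V → Fin N) : Finset (Finset (V → Fin N)) :=
  univ.filter fun C => Conflict t k C ∧ B ∈ C ∧ 3 ≤ C.card

lemma mem_bigConflicts {t k : ℕ} {B : V → Fin N} {C : Finset (V → Fin N)} :
    C ∈ bigConflicts t k B ↔ Conflict t k C ∧ B ∈ C ∧ 3 ≤ C.card := by
  simp [bigConflicts]

lemma sum_bigConflicts_le [Nonempty V] (hN : 0 < N) {t k Q j J : ℕ} [NeZero Q] (hk : 2 ≤ k)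
    (ht : t < Fintype.card V) (hj : j ≤ J) (B : V → Fin N) {c : ℝ} (hc1 : 1 ≤ c)
    (hc : prob (fun x : Fin Q => (x : ℕ) < J) * (N : ℝ) ^ (Fintype.card V - t) ≤ c)
    (hrare : c ^ k * (rareConst (Fintype.card V) t k (2 * (1 + J * k) + k) (k * c) / N) ≤ 1) :
    ∑ C ∈ bigConflicts t k B, prob (fun ω : (V → Fin N) → Fin Q =>
      ∀ b ∈ C.erase B, b ∈ accepted (Conflict t k) (fun x => (ω x : ℕ)) j) ≤
    2 * ∑ s ∈ range (k + 1), (conflictConst (Fintype.card V) t s : ℝ) := by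
  classical
  set p := prob (fun x : Fin Q => (x : ℕ) < J) with hp
  set D : ℝ := (N : ℝ) ^ (Fintype.card V - t) with hD
  set ρ := rareConst (Fintype.card V) t k (2 * (1 + J * k) + k) (k * c) / N with hρ
  have hρ0 : 0 ≤ ρ := div_nonneg (rareConst_nonneg _ _ _ _ (by positivity)) (by positivity)
  have hp0 : 0 ≤ p := prob_nonneg _
  have hA0 : 0 ≤ acceptProb t k Q j B := prob_nonneg _
  have hDA : D * acceptProb t k Q j B ≤ 1 := pow_mul_acceptProb_le_one hk ht.le Q j B
  have hD0 : 0 ≤ D := by positivity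
  have hterm : ∀ C ∈ bigConflicts t k B, prob (fun ω : (V → Fin N) → Fin Q =>
      ∀ b ∈ C.erase B, b ∈ accepted (Conflict t k) (fun x => (ω x : ℕ)) j) ≤
      acceptProb t k Q j B ^ (C.card - 1) + p ^ (C.card - 1) * ρ := by
    intro C hC
    obtain ⟨hC, hB, h3⟩ := mem_bigConflicts.1 hC
    have hcard := Finset.card_erase_of_mem hB
    have := hC.2.1
    rw [← hcard]
    exact prob_forall_accepted_le hN ht hj (by omega) (Finset.card_pos.1 (by omega))
      (fun S hS h2 => hC.2.2.2 S (hS.trans_ssubset (Finset.erase_ssubset hB)) h2) B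
      (by rw [mul_assoc]; gcongr)
  rw [Finset.mul_sum]
  rw [← Finset.sum_fiberwise_of_maps_to (t := range (k + 1)) (g := fun C => C.card)]
  · refine Finset.sum_le_sum fun s hs => ?_
    rw [Finset.mem_range] at hs
    calc _ ≤ ∑ C ∈ (bigConflicts t k B).filter (fun C => C.card = s),
          (acceptProb t k Q j B ^ (s - 1) + p ^ (s - 1) * ρ) := by
          refine Finset.sum_le_sum fun C hC => ?_
          rw [Finset.mem_filter] at hC
          rw [← hC.2]
          exact hterm C hC.1
      _ ≤ (conflictConst (Fintype.card V) t s * D ^ (s - 1)) *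
          (acceptProb t k Q j B ^ (s - 1) + p ^ (s - 1) * ρ) := by
          rw [Finset.sum_const, nsmul_eq_mul]
          gcongr
          have h := card_conflict_le hN (k := k) (s := s) ht B
          refine le_trans (Nat.cast_le.2 (Finset.card_le_card fun C hC => ?_))
            ((Nat.cast_le (α := ℝ).2 h).trans (by rw [hD]; push_cast; rfl))
          rw [Finset.mem_filter, mem_bigConflicts] at hC
          simp [hC.1.1, hC.1.2.1, hC.2]
      _ = conflictConst (Fintype.card V) t s *
          ((D * acceptProb t k Q j B) ^ (s - 1) + (p * D) ^ (s - 1) * ρ) := by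
          rw [mul_pow, mul_pow]; ring
      _ ≤ conflictConst (Fintype.card V) t s * (1 + 1) := by
          gcongr
          · exact pow_le_one₀ (by positivity) hDA
          · refine le_trans ?_ hrare
            gcongr
            calc (p * D) ^ (s - 1) ≤ c ^ (s - 1) := by gcongr
              _ ≤ c ^ k := pow_le_pow_right₀ hc1 (by omega)
      _ = _ := by ring
  · intro C hC
    have := (mem_bigConflicts.1 hC).1.2.1
    rw [Finset.mem_range]
    omega

lemma Conflict.agree_of_eq_pair {t k : ℕ} {B b : V → Fin N} (hb : b ≠ B)
    (hC : Conflict t k {B, b}) : t ≤ (agree B b).card := by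
  have := hC.2.2.1
  rw [excess_pair t hb.symm, ← card_agree] at this
  omega

lemma pair_right_inj {α : Type*} [DecidableEq α] {B b b' : α} (hb : b ≠ B)
    (h : ({B, b} : Finset α) = {B, b'}) : b = b' := by
  have : b ∈ ({B, b'} : Finset α) := by rw [← h]; simp
  simpa [hb] using this

/-- The number of groups of large conflicts. -/
def groupCount (m t k : ℕ) : ℕ := 8 * ∑ s ∈ range (k + 1), conflictConst m t s

lemma groupCount_pos {m : ℕ} (hm : 0 < m) (t k : ℕ) : 0 < groupCount m t k := by
  unfold groupCount conflictConst
  have : 0 < m ^ ((m - t) * (0 - 1)) * 2 ^ (1 + (m - t) * (0 - 1)) ^ m := by positivity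
  have h := Finset.single_le_sum (f := fun s => m ^ ((m - t) * (s - 1)) *
    2 ^ (1 + (m - t) * (s - 1)) ^ m) (fun _ _ => Nat.zero_le _)
    (Finset.mem_range.2 (Nat.succ_pos k))
  exact Nat.mul_pos (by norm_num) (this.trans_le h)

theorem le_prob_available [Nonempty V] (hN : 0 < N) {t k Q j J : ℕ} [NeZero Q] (hk : 2 ≤ k)
    (ht : t < Fintype.card V) (hj : j ≤ J) (B : V → Fin N) {c ε : ℝ} (hc1 : 1 ≤ c)
    (hc : prob (fun x : Fin Q => (x : ℕ) < J) * (N : ℝ) ^ (Fintype.card V - t) ≤ c)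
    (hrare : c ^ k * (rareConst (Fintype.card V) t k (2 * (1 + J * k) + k) (k * c) / N) ≤ 1)
    (hp : prob (fun x : Fin Q => (x : ℕ) < J) ≤ 1 / 4) (hε : 0 ≤ ε)
    (hpε : prob (fun x : Fin Q => (x : ℕ) < J) ≤ ε / 2)
    (hA : (N : ℝ) ^ (Fintype.card V - t) * acceptProb t k Q j B ≤ 1 - ε) :
    (ε / 2) ^ (Fintype.card V).choose t * (1 / 4) ^ groupCount (Fintype.card V) t k -
      rareConst (Fintype.card V) t 1 (2 * (1 + J * k) + 2 * k)
        (((Fintype.card V).choose t + groupCount (Fintype.card V) t k) * c) / N ≤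
    prob (fun ω : (V → Fin N) → Fin Q =>
      AvailableFor t k J j B (fun _ => True) fun x => (ω x : ℕ)) := by
  classical
  set L := groupCount (Fintype.card V) t k with hL
  have hLpos : 0 < L := groupCount_pos Fintype.card_pos t k
  set w : Finset (V → Fin N) → ℝ := fun C => prob (fun ω : (V → Fin N) → Fin Q =>
      ∀ b ∈ C.erase B, b ∈ accepted (Conflict t k) (fun x => (ω x : ℕ)) j) with hw
  obtain ⟨col, hcol⟩ := exists_coloring (bigConflicts t k B) w (by
      intro C hC
      obtain ⟨-, hB, h3⟩ := mem_bigConflicts.1 hC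
      obtain ⟨b, hb⟩ := Finset.card_pos.1 (by
        rw [Finset.card_erase_of_mem hB]; omega : 0 < (C.erase B).card)
      refine le_trans (prob_mono fun ω h => ?_) ((prob_label_lt Q J b).trans_le hp)
      exact (label_lt_of_mem_accepted (h b hb)).trans_le hj)
    (fun _ _ => prob_nonneg _) hLpos (by
      refine (sum_bigConflicts_le hN hk ht hj B hc1 hc hrare).trans (le_of_eq ?_)
      rw [hL, groupCount]
      push_cast
      ring)
  set G : (powersetCard t (univ : Finset V)) ⊕ Fin L → Finset (V → Fin N) → Prop :=
    Sum.elim (fun T C => ∃ b, b ≠ B ∧ C = {B, b} ∧ (T : Finset V) ⊆ agree B b)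
      (fun l C => 3 ≤ C.card ∧ col C = l) with hG
  have : Nonempty ((powersetCard t (univ : Finset V)) ⊕ Fin L) := ⟨Sum.inr ⟨0, hLpos⟩⟩
  have hcov : ∀ C, Conflict t k C → B ∈ C → ∃ g, G g C := by
    intro C hC hB
    by_cases h3 : 3 ≤ C.card
    · exact ⟨Sum.inr (col C), h3, rfl⟩
    · have h2 : (C.erase B).card = 1 := by
        have := hC.1
        rw [Finset.card_erase_of_mem hB]; omega
      obtain ⟨b, hb⟩ := Finset.card_eq_one.1 h2
      have hbB : b ≠ B := by
        have : b ∈ C.erase B := by simp [hb]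
        exact (Finset.mem_erase.1 this).1
      have hCb : C = {B, b} := by rw [← Finset.insert_erase hB, hb]
      obtain ⟨T, hT, hTc⟩ := Finset.exists_subset_card_eq
        (Conflict.agree_of_eq_pair hbB (by rwa [← hCb] : Conflict t k {B, b}))
      exact ⟨Sum.inl ⟨T, by simp [hTc]⟩, b, hbB, hCb, hT⟩
  have hmain := prod_prob_availableFor_le hN ht hj B G hcov (by
      have hpair : ∀ {C : Finset (V → Fin N)} {b}, C = {B, b} → C.card ≤ 2 := by
        rintro C b rfl; exact Finset.card_le_two
      rintro (T | l) (T' | l') C C' hgC hgC' hC hC' hB hB' hW hne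
      · obtain ⟨b, hbB, hCb, hTb⟩ := hgC
        obtain ⟨b', hbB', hCb', hTb'⟩ := hgC'
        have hT := (Finset.mem_powersetCard.1 T.2).2
        have hT' := (Finset.mem_powersetCard.1 T'.2).2
        have key : agree B b = agree B b' ∧ (agree B b).card ≤ t := by
          by_cases h : C = C'
          · have hbb := pair_right_inj hbB (hCb.symm.trans (h.trans hCb'))
            have := hW C subset_rfl hB
            rw [hCb, excess_pair t hbB.symm, ← card_agree] at this
            exact ⟨by rw [hbb], by omega⟩
          · obtain ⟨b₁, b₁', h1, h1', h2, h3⟩ := hne h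
            obtain rfl := pair_right_inj hbB (hCb.symm.trans h1)
            obtain rfl := pair_right_inj hbB' (hCb'.symm.trans h1')
            exact ⟨h2, h3.le⟩
        have e1 := Finset.eq_of_subset_of_card_le hTb (by omega)
        have e2 := Finset.eq_of_subset_of_card_le hTb' (by rw [← key.1]; omega)
        rw [Subtype.ext (e1.trans (key.1.trans e2.symm))]
      · obtain ⟨b, hbB, hCb, hTb⟩ := hgC
        have h3 := hgC'.1
        have h2 := hpair hCb
        obtain ⟨_, _, -, h1, -⟩ := hne fun e => by rw [e] at h2; omega
        have := hpair h1
        omega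
      · obtain ⟨b, hbB, hCb, hTb⟩ := hgC'
        have h3 := hgC.1
        have h2 := hpair hCb
        obtain ⟨_, _, h1, -⟩ := hne fun e => by rw [← e] at h2; omega
        have := hpair h1
        omega
      · by_cases h : C = C'
        · rw [← hgC.2, ← hgC'.2, h]
        · obtain ⟨_, _, h1, -⟩ := hne h
          have := hpair h1
          have := hgC.1
          omega) (Q := Q) (c := ((Fintype.card V).choose t + L) * c) (by
      have hcard : (Fintype.card ((powersetCard t (univ : Finset V)) ⊕ Fin L) : ℝ) =
          (Fintype.card V).choose t + L := by
        rw [Fintype.card_sum, Fintype.card_fin, Fintype.card_coe, Finset.card_powersetCard,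
          Finset.card_univ]
        push_cast
        rfl
      rw [hcard, mul_assoc]
      gcongr)
  refine le_trans (sub_le_sub_right ?_ _) hmain
  rw [Fintype.prod_sum_type]
  refine mul_le_mul ?_ ?_ (by positivity) (Finset.prod_nonneg fun _ _ => prob_nonneg _)
  · have h := Finset.prod_le_prod (s := (univ : Finset (powersetCard t (univ : Finset V))))
      (f := fun _ => ε / 2) (g := fun T => prob (fun ω : (V → Fin N) → Fin Q =>
        AvailableFor t k J j B (G (Sum.inl T)) fun x => (ω x : ℕ)))
      (fun _ _ => by positivity) (fun T _ => by
        refine le_trans ?_ (le_prob_availableFor_pair hj B (Finset.mem_powersetCard.1 T.2).2)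
        linarith)
    simpa [Finset.card_powersetCard, div_pow] using h
  · have h := Finset.prod_le_prod (s := (univ : Finset (Fin L)))
      (f := fun _ => (1 / 4 : ℝ)) (g := fun l => prob (fun ω : (V → Fin N) → Fin Q =>
        AvailableFor t k J j B (G (Sum.inr l)) fun x => (ω x : ℕ)))
      (fun _ _ => by positivity) (fun l _ => by
        refine le_trans ?_ (le_prob_availableFor hj B _)
        have h1 : prob (fun ω : (V → Fin N) → Fin Q =>
            ∃ C, G (Sum.inr l) C ∧ Conflict t k C ∧ B ∈ C ∧
            ∀ b ∈ C.erase B, b ∈ accepted (Conflict t k) (fun x => (ω x : ℕ)) j) ≤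
            ∑ C ∈ bigConflicts t k B with col C = l, w C := by
          refine le_trans (prob_mono fun ω h => ?_) (prob_exists_le _ _)
          obtain ⟨C, ⟨h3, hl⟩, hC, hB, hacc⟩ := h
          exact ⟨C, by simp [mem_bigConflicts, hC, hB, h3, hl], hacc⟩
        have h2 := hcol l
        linarith)
    simpa using h

end AvailableBound

section Independence

lemma prob_prod {Ω Ω' : Type*} [Fintype Ω] [Fintype Ω'] (E : Ω → Prop) (E' : Ω' → Prop) :
    prob (fun x : Ω × Ω' => E x.1 ∧ E' x.2) = prob E * prob E' := by
  classical
  simp only [prob_def]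
  rw [div_mul_div_comm, Fintype.card_prod, ← Finset.univ_product_univ, Finset.filter_product,
    Finset.card_product]
  push_cast
  rfl

lemma prob_and_of_update {β R : Type*} [Fintype β] [DecidableEq β] [Fintype R] [Nonempty R]
    (b : β) (L : R → Prop) (E : (β → R) → Prop)
    (hE : ∀ ω ω', (∀ x, x ≠ b → ω x = ω' x) → E ω → E ω') :
    prob (fun ω : β → R => L (ω b) ∧ E ω) = prob L * prob E := by
  obtain ⟨r⟩ := ‹Nonempty R›
  have : Nonempty R := ⟨r⟩
  set e := Equiv.funSplitAt b R with he
  set E' : ({x // x ≠ b} → R) → Prop := fun y => E (e.symm (r, y)) with hE'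
  have hEE : ∀ ω, E ω ↔ E' (e ω).2 := by
    have h : ∀ ω x, x ≠ b → ω x = e.symm (r, (e ω).2) x := by
      intro ω x hx
      simp [he, hx]
    exact fun ω => ⟨hE _ _ (h ω), hE _ _ fun x hx => (h ω x hx).symm⟩
  have h1 : prob E = prob E' := by
    have h2 := prob_prod (fun _ : R => True) E'
    rw [prob_true, one_mul, ← prob_comp_equiv e] at h2
    rw [← h2]
    congr 1
    funext ω
    simp [hEE]
  rw [h1, ← prob_prod, ← prob_comp_equiv e]
  congr 1
  funext ω
  rw [hEE]
  rfl

lemma prob_fin_lt {Q J : ℕ} (h : J ≤ Q) :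
    prob (fun x : Fin Q => (x : ℕ) < J) = (J : ℝ) / Q := by
  rw [prob_def, Fin.card_filter_val_lt, Fintype.card_fin, min_eq_right h]

lemma prob_fin_eq {Q j : ℕ} (h : j < Q) :
    prob (fun x : Fin Q => (x : ℕ) = j) = 1 / (Q : ℝ) := by
  rw [prob_def, Fintype.card_fin]
  have : (univ.filter fun x : Fin Q => (x : ℕ) = j) = {⟨j, h⟩} := by
    ext x; simp [Fin.ext_iff]
  rw [this]
  simp

end Independence

/-! ### Evolution of the acceptance probability -/

section Evolution

variable {V : Type*} [DecidableEq V] [Fintype V] {N : ℕ}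

/-- Some conflict through `B` has all labels below `J`, and one of its other blocks has
label `j`. -/
def Crowded (t k J j : ℕ) (B : V → Fin N) (ω : (V → Fin N) → ℕ) : Prop :=
  ∃ C, Conflict t k C ∧ B ∈ C ∧ ∃ b ∈ C.erase B, ω b = j ∧ ∀ x ∈ C, ω x < J

lemma mem_accepted_succ_of_available {t k J j : ℕ} (hj : j < J) {B : V → Fin N}
    {ω : (V → Fin N) → ℕ} (hB : ω B = j) (hav : AvailableFor t k J j B (fun _ => True) ω)
    (hcr : ¬ Crowded t k J j B ω) : B ∈ accepted (Conflict t k) ω (j + 1) := by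
  refine mem_accepted_succ.2 (Or.inr ⟨hB, fun C hC hBC => ?_⟩)
  obtain ⟨b, hb, hbB, hna⟩ := hav C trivial hC hBC
  rw [accepted_update_of_le hj.le hB.ge] at hna
  by_contra! hcon
  refine hcr ⟨C, hC, hBC, b, Finset.mem_erase.2 ⟨hbB, hb⟩, hcon b hb hbB hna, fun x hx => ?_⟩
  by_cases hxB : x = B
  · rw [hxB, hB]; exact hj
  · by_cases hxa : x ∈ accepted (Conflict t k) ω j
    · exact (label_lt_of_mem_accepted hxa).trans hj
    · rw [hcon x hx hxB hxa]; exact hj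

lemma prob_crowded_le [Nonempty V] (hN : 0 < N) {t k Q j J : ℕ} [NeZero Q]
    (ht : t < Fintype.card V) (hj : j < Q) (B : V → Fin N) :
    prob (fun ω : (V → Fin N) → Fin Q => (ω B : ℕ) = j ∧
      Crowded t k J j B fun x => (ω x : ℕ)) ≤
    ∑ s ∈ Icc 2 k, conflictConst (Fintype.card V) t s *
      ((N : ℝ) ^ (Fintype.card V - t)) ^ (s - 1) * (s * ((1 / (Q : ℝ)) ^ 2 *
        prob (fun x : Fin Q => (x : ℕ) < J) ^ (s - 2))) := by
  classical
  set p := prob (fun x : Fin Q => (x : ℕ) < J) with hp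
  have hp0 : 0 ≤ p := prob_nonneg _
  set T : Finset (Finset (V → Fin N)) := univ.filter fun C => Conflict t k C ∧ B ∈ C with hT
  have hone : ∀ C ∈ T, ∀ b ∈ C.erase B, prob (fun ω : (V → Fin N) → Fin Q =>
      ∀ x ∈ C, if x = B ∨ x = b then (ω x : ℕ) = j else (ω x : ℕ) < J) =
      (1 / (Q : ℝ)) ^ 2 * p ^ (C.card - 2) := by
    intro C hC b hb
    have hBC : B ∈ C := (Finset.mem_filter.1 hC).2.2
    rw [prob_forall_mem C fun x (r : Fin Q) => if x = B ∨ x = b then (r : ℕ) = j else (r : ℕ) < J,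
      ← Finset.mul_prod_erase _ _ hBC, ← Finset.mul_prod_erase _ _ hb]
    have h1 : ∀ x ∈ (C.erase B).erase b, prob (fun r : Fin Q =>
        if x = B ∨ x = b then (r : ℕ) = j else (r : ℕ) < J) = p := by
      intro x hx
      simp only [Finset.mem_erase] at hx
      simp [hx.1, hx.2.1, hp]
    rw [Finset.prod_eq_pow_card h1, Finset.card_erase_of_mem hb, Finset.card_erase_of_mem hBC]
    simp only [true_or, or_true, if_true, prob_fin_eq hj]
    rw [Nat.sub_sub]
    ring
  calc _ ≤ prob (fun ω : (V → Fin N) → Fin Q => ∃ C ∈ T, ∃ b ∈ C.erase B,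
        ∀ x ∈ C, if x = B ∨ x = b then (ω x : ℕ) = j else (ω x : ℕ) < J) := by
        refine prob_mono fun ω h => ?_
        obtain ⟨hB, C, hC, hBC, b, hb, hbj, hx⟩ := h
        refine ⟨C, by simp [hT, hC, hBC], b, hb, fun x hxC => ?_⟩
        split_ifs with h
        · rcases h with rfl | rfl <;> assumption
        · exact hx x hxC
    _ ≤ ∑ C ∈ T, prob (fun ω : (V → Fin N) → Fin Q => ∃ b ∈ C.erase B,
        ∀ x ∈ C, if x = B ∨ x = b then (ω x : ℕ) = j else (ω x : ℕ) < J) := prob_exists_le _ _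
    _ ≤ ∑ C ∈ T, (C.card : ℝ) * ((1 / (Q : ℝ)) ^ 2 * p ^ (C.card - 2)) := by
        refine Finset.sum_le_sum fun C hC => (prob_exists_le _ _).trans ?_
        rw [Finset.sum_congr rfl (hone C hC), Finset.sum_const, nsmul_eq_mul]
        gcongr
        exact Finset.erase_subset _ _
    _ ≤ _ := by
        rw [← Finset.sum_fiberwise_of_maps_to (t := Icc 2 k) (g := fun C => C.card)]
        · refine Finset.sum_le_sum fun s _ => ?_
          rw [Finset.sum_congr rfl (g := fun _ => (s : ℝ) * ((1 / (Q : ℝ)) ^ 2 * p ^ (s - 2)))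
            fun C hC => by rw [(Finset.mem_filter.1 hC).2], Finset.sum_const, nsmul_eq_mul]
          gcongr
          refine le_trans (Nat.cast_le.2 (Finset.card_le_card fun C hC => ?_))
            ((Nat.cast_le (α := ℝ).2 (card_conflict_le hN (k := k) (s := s) ht B)).trans
              (by push_cast; rfl))
          rw [Finset.mem_filter, hT, Finset.mem_filter] at hC
          simp [hC.1.2.1, hC.1.2.2, hC.2]
        · intro C hC
          have hC := (Finset.mem_filter.1 hC).2.1
          exact Finset.mem_Icc.2 ⟨hC.1, hC.2.1⟩

lemma acceptProb_succ_ge {t k Q j J : ℕ} [NeZero Q] (hj : j < J) (hQ : j < Q) (B : V → Fin N) :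
    acceptProb t k Q j B + 1 / Q * prob (fun ω : (V → Fin N) → Fin Q =>
      AvailableFor t k J j B (fun _ => True) fun x => (ω x : ℕ)) -
      prob (fun ω : (V → Fin N) → Fin Q => (ω B : ℕ) = j ∧
        Crowded t k J j B fun x => (ω x : ℕ)) ≤ acceptProb t k Q (j + 1) B := by
  have h1 := prob_and_of_update B (fun x : Fin Q => (x : ℕ) = j)
    (fun ω : (V → Fin N) → Fin Q =>
      AvailableFor t k J j B (fun _ => True) fun x => (ω x : ℕ)) (by
    intro ω ω' h hav C hG hC hB
    have : Function.update (fun x => (ω' x : ℕ)) B J = Function.update (fun x => (ω x : ℕ)) B J := by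
      funext x
      by_cases e : x = B
      · subst e; simp
      · rw [Function.update_of_ne e, Function.update_of_ne e, h x e]
    rw [this]
    exact hav C hG hC hB)
  rw [prob_fin_eq hQ] at h1
  have h2 : prob (fun ω : (V → Fin N) → Fin Q => (ω B : ℕ) = j ∧
      AvailableFor t k J j B (fun _ => True) fun x => (ω x : ℕ)) ≤
      prob (fun ω : (V → Fin N) → Fin Q => (ω B : ℕ) = j ∧
        B ∈ accepted (Conflict t k) (fun x => (ω x : ℕ)) (j + 1)) +
      prob (fun ω : (V → Fin N) → Fin Q => (ω B : ℕ) = j ∧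
        Crowded t k J j B fun x => (ω x : ℕ)) := by
    refine (prob_mono fun ω h => ?_).trans (prob_or_le _ _)
    by_cases hcr : Crowded t k J j B fun x => (ω x : ℕ)
    · exact Or.inr ⟨h.1, hcr⟩
    · exact Or.inl ⟨h.1, mem_accepted_succ_of_available hj h.1 h.2 hcr⟩
  have h3 : acceptProb t k Q j B + prob (fun ω : (V → Fin N) → Fin Q => (ω B : ℕ) = j ∧
        B ∈ accepted (Conflict t k) (fun x => (ω x : ℕ)) (j + 1)) ≤
      acceptProb t k Q (j + 1) B :=
    prob_disjoint_add_le (fun ω h h' => (label_lt_of_mem_accepted h).ne h'.1)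
      (fun ω h => accepted_mono (Nat.le_succ j) h) (fun ω h => h.2)
  linarith

/-- The constant bounding the loss from simultaneous labels. -/
noncomputable def crowdConst (m t k : ℕ) (a : ℝ) : ℝ :=
  ∑ s ∈ Icc 2 k, conflictConst m t s * (s * a ^ (s - 2))

lemma scaled_acceptProb_succ_ge [Nonempty V] (hN : 0 < N) {t k g j J : ℕ} {a : ℝ} (hg : 0 < g)
    (ht : t < Fintype.card V) (hj : j < J) (hJ : J ≤ g * N ^ (Fintype.card V - t))
    (ha : (J : ℝ) = a * g) (B : V → Fin N) :
    (N : ℝ) ^ (Fintype.card V - t) * acceptProb t k (g * N ^ (Fintype.card V - t)) j B +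
      1 / g * (prob (fun ω : (V → Fin N) → Fin (g * N ^ (Fintype.card V - t)) =>
        AvailableFor t k J j B (fun _ => True) fun x => (ω x : ℕ)) -
        crowdConst (Fintype.card V) t k a / g) ≤
    (N : ℝ) ^ (Fintype.card V - t) *
      acceptProb t k (g * N ^ (Fintype.card V - t)) (j + 1) B := by
  set Q := g * N ^ (Fintype.card V - t) with hQ
  set D : ℝ := (N : ℝ) ^ (Fintype.card V - t) with hD
  have hQpos : 0 < Q := by positivity
  have : NeZero Q := ⟨hQpos.ne'⟩
  have hNR : (0 : ℝ) < N := by exact_mod_cast hN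
  have hgR : (0 : ℝ) < g := by exact_mod_cast hg
  have hDpos : 0 < D := by positivity
  have hQD : (Q : ℝ) = g * D := by rw [hQ, hD]; push_cast; rfl
  have h1 := acceptProb_succ_ge (t := t) (k := k) hj (hj.trans_le hJ) B
  have h2 := prob_crowded_le (k := k) (J := J) hN ht (hj.trans_le hJ) B
  rw [prob_fin_lt hJ, ← hD, hQD, ha] at h2
  have h3 : D * ∑ s ∈ Icc 2 k, conflictConst (Fintype.card V) t s * D ^ (s - 1) *
      (s * ((1 / (g * D)) ^ 2 * (a * g / (g * D)) ^ (s - 2))) =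
      1 / g * (crowdConst (Fintype.card V) t k a / g) := by
    rw [crowdConst, Finset.mul_sum, Finset.sum_div, Finset.mul_sum]
    refine Finset.sum_congr rfl fun s hs => ?_
    obtain ⟨e, rfl⟩ : ∃ e, s = e + 2 := ⟨s - 2, by have := (Finset.mem_Icc.1 hs).1; omega⟩
    have e1 : e + 2 - 1 = e + 1 := rfl
    have e2 : a ^ e = (a * g / (g * D)) ^ e * D ^ e := by
      rw [← mul_pow]
      congr 1
      field_simp
    rw [e1, Nat.add_sub_cancel, e2]
    generalize (a * g / (g * D)) ^ e = y
    field_simp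
    ring
  have h4 := mul_le_mul_of_nonneg_left (h1.trans' (sub_le_sub_left h2 _)) hDpos.le
  rw [mul_sub, h3, mul_add, hQD] at h4
  have h5 : ∀ x : ℝ, D * (1 / (g * D) * x) = 1 / g * x := by
    intro x; field_simp
  rw [h5] at h4
  linarith

end Evolution

/-! ### Existence of almost complete packings of blocks -/

section Packing

lemma eventually_div_natCast_le (C : ℝ) {δ : ℝ} (hδ : 0 < δ) :
    ∀ᶠ N : ℕ in atTop, C / N ≤ δ :=
  ((tendsto_const_div_atTop_nhds_zero_nat C).eventually_lt_const hδ).mono fun _ h => h.le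

theorem exists_packing (V : Type*) [DecidableEq V] [Fintype V] {t k : ℕ} (hk : 2 ≤ k)
    (ht : t < Fintype.card V) {ε : ℝ} (hε : 0 < ε) :
    ∀ᶠ N : ℕ in atTop, ∃ P : Finset (V → Fin N), (1 - ε) * (N : ℝ) ^ t ≤ P.card ∧
      ∀ S ⊆ P, 2 ≤ S.card → S.card ≤ k → t < excess t S := by
  classical
  have hV : Nonempty V := Fintype.card_pos_iff.1 (by omega)
  set m := Fintype.card V with hm
  set h₀ : ℝ := (ε / 2) ^ m.choose t * (1 / 4) ^ groupCount m t k with hh₀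
  set h : ℝ := h₀ / 2 with hh
  have hpos : 0 < h := by positivity
  obtain ⟨a, ha⟩ := exists_nat_gt (2 / h)
  have ha0 : (0 : ℝ) < a := lt_trans (by positivity) ha
  have ha1 : (1 : ℝ) ≤ a := by
    have : 0 < a := by exact_mod_cast ha0
    exact_mod_cast this
  obtain ⟨g, hg⟩ := exists_nat_gt (2 * crowdConst m t k a / h)
  have hK0 : 0 ≤ crowdConst m t k a := by unfold crowdConst; positivity
  have hgR : (0 : ℝ) < g := lt_of_le_of_lt (by positivity) hg
  have hg0 : 0 < g := by exact_mod_cast hgR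
  set J := a * g with hJ
  have hJR : (J : ℝ) = a * g := by rw [hJ]; push_cast; rfl
  filter_upwards [eventually_ge_atTop (max 1 a),
    eventually_div_natCast_le (a ^ k * rareConst m t k (2 * (1 + J * k) + k) (k * a)) one_pos,
    eventually_div_natCast_le (rareConst m t 1 (2 * (1 + J * k) + 2 * k)
      ((m.choose t + groupCount m t k) * a)) hpos,
    eventually_div_natCast_le a (by norm_num : (0 : ℝ) < 1 / 4),
    eventually_div_natCast_le a (half_pos hε)] with N hN1 hN2 hN3 hN4 hN5
  have hN : 0 < N := lt_of_lt_of_le one_pos ((le_max_left _ _).trans hN1)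
  have haN : a ≤ N := (le_max_right _ _).trans hN1
  have hNR : (0 : ℝ) < N := by exact_mod_cast hN
  have hND : N ≤ N ^ (m - t) := Nat.le_self_pow (by omega) N
  set Q := g * N ^ (m - t) with hQ
  have hQ0 : NeZero Q := ⟨(by positivity : 0 < Q).ne'⟩
  have hJQ : J ≤ Q := by
    rw [hJ, hQ, mul_comm a]
    exact Nat.mul_le_mul_left g (haN.trans hND)
  have hDpos : (0 : ℝ) < (N : ℝ) ^ (m - t) := by positivity
  have hpa : prob (fun x : Fin Q => (x : ℕ) < J) = a / (N : ℝ) ^ (m - t) := by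
    rw [prob_fin_lt hJQ, hJR, hQ]
    push_cast
    field_simp
  have hpN : prob (fun x : Fin Q => (x : ℕ) < J) ≤ a / N := by
    rw [hpa]
    gcongr
    exact_mod_cast hND
  set B : V → Fin N := fun _ => ⟨0, hN⟩
  set α : ℕ → ℝ := fun j => (N : ℝ) ^ (m - t) * acceptProb t k Q j B with hα
  have hαJ : 1 - ε ≤ α J := by
    by_contra! hcon
    have hstep : ∀ j < J, α j + h / (2 * g) ≤ α (j + 1) := by
      intro j hj
      have hαj : α j ≤ 1 - ε := le_trans (mul_le_mul_of_nonneg_left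
        (acceptProb_mono t k Q B hj.le) hDpos.le) hcon.le
      have h1 := scaled_acceptProb_succ_ge (k := k) hN hg0 ht hj hJQ hJR B
      have h2 := le_prob_available hN hk ht hj.le B ha1
        (by rw [hpa, div_mul_cancel₀ _ hDpos.ne']) (by rwa [← mul_div_assoc])
        (hpN.trans hN4) hε.le (hpN.trans hN5) hαj
      have h3 : crowdConst m t k a / g ≤ h / 2 := by
        rw [div_lt_iff₀ hpos] at hg
        rw [div_le_iff₀ hgR]
        linarith
      have h4 : h / 2 ≤ prob (fun ω : (V → Fin N) → Fin Q =>
          AvailableFor t k J j B (fun _ => True) fun x => (ω x : ℕ)) -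
          crowdConst m t k a / g := by
        linarith
      have h5 : h / (2 * g) = 1 / g * (h / 2) := by field_simp
      refine le_trans ?_ h1
      rw [h5]
      gcongr
    have hind : ∀ j ≤ J, j * (h / (2 * g)) ≤ α j := by
      intro j hj
      induction j with
      | zero =>
        rw [Nat.cast_zero, zero_mul]
        exact mul_nonneg hDpos.le (prob_nonneg _)
      | succ j ih =>
        have := ih (by omega)
        have := hstep j (by omega)
        push_cast
        linarith
    have h6 := hind J le_rfl
    have h7 : (J : ℝ) * (h / (2 * g)) = a * h / 2 := by
      rw [hJR]; field_simp
    rw [div_lt_iff₀ hpos] at ha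
    linarith
  have : Nonempty (Fin Q) := ⟨⟨0, Nat.pos_of_ne_zero hQ0.out⟩⟩
  obtain ⟨ω, hω⟩ := exists_sum_prob_le (Ω := (V → Fin N) → Fin Q) univ
    fun b ω => b ∈ accepted (Conflict t k) (fun x => (ω x : ℕ)) J
  refine ⟨_, le_trans ?_ hω, fun S hS => lt_excess_of_subset_accepted fun b hb =>
    (Finset.mem_filter.1 (hS hb)).2⟩
  have hsum : ∑ b : V → Fin N, prob (fun ω : (V → Fin N) → Fin Q =>
      b ∈ accepted (Conflict t k) (fun x => (ω x : ℕ)) J) = (N : ℝ) ^ t * α J := by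
    have h1 : ∀ b ∈ (univ : Finset (V → Fin N)), prob (fun ω : (V → Fin N) → Fin Q =>
        b ∈ accepted (Conflict t k) (fun x => (ω x : ℕ)) J) = acceptProb t k Q J B :=
      fun b _ => acceptProb_eq t k Q J b B
    rw [Finset.sum_congr rfl h1, Finset.sum_const, nsmul_eq_mul, Finset.card_univ,
      Fintype.card_fun, Fintype.card_fin, hα]
    push_cast
    rw [← hm, ← mul_assoc, ← pow_add, Nat.add_sub_of_le ht.le]
  rw [hsum, mul_comm]
  gcongr

end Packing

/-! ### Placing copies of a hypergraph into blocks -/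

section Placement

variable {V : Type*} [DecidableEq V] {N : ℕ}

/-- The copy of the vertex set `p.1` inside the block `p.2`. -/
def placed (p : Finset V × (V → Fin N)) : Finset (V × Fin N) := p.1.image fun v => (v, p.2 v)

lemma mem_placed {p : Finset V × (V → Fin N)} {x : V × Fin N} :
    x ∈ placed p ↔ x.1 ∈ p.1 ∧ p.2 x.1 = x.2 := by
  simp only [placed, Finset.mem_image]
  constructor
  · rintro ⟨v, hv, rfl⟩; exact ⟨hv, rfl⟩
  · rintro ⟨h, h'⟩; exact ⟨x.1, h, by rw [h']⟩

lemma card_placed (p : Finset V × (V → Fin N)) : (placed p).card = p.1.card :=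
  Finset.card_image_of_injective _ fun _ _ h => (Prod.ext_iff.1 h).1

variable [Fintype V]

/-- The edges of `T` that sit in the block `b`. -/
def edgesIn (T : Finset (Finset V × (V → Fin N))) (b : V → Fin N) : Finset (Finset V) :=
  (T.filter fun p => p.2 = b).image Prod.fst

lemma mem_edgesIn {T : Finset (Finset V × (V → Fin N))} {b : V → Fin N} {e : Finset V} :
    e ∈ edgesIn T b ↔ (e, b) ∈ T := by
  simp only [edgesIn, Finset.mem_image, Finset.mem_filter]
  constructor
  · rintro ⟨p, ⟨hp, rfl⟩, rfl⟩; exact hp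
  · intro h; exact ⟨(e, b), ⟨h, rfl⟩, rfl⟩

lemma card_edgesIn (T : Finset (Finset V × (V → Fin N))) (b : V → Fin N) :
    (edgesIn T b).card = (T.filter fun p => p.2 = b).card := by
  apply Finset.card_image_of_injOn
  intro p hp q hq h
  simp only [Finset.coe_filter, Set.mem_ofPred_eq] at hp hq
  exact Prod.ext h (hp.2.trans hq.2.symm)

lemma sum_card_edgesIn (T : Finset (Finset V × (V → Fin N))) :
    ∑ b ∈ T.image Prod.snd, (edgesIn T b).card = T.card := by
  simp_rw [card_edgesIn]
  exact (Finset.card_eq_sum_card_image Prod.snd T).symm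

lemma lt_card_biUnion_placed {k r t : ℕ} (hk : 2 ≤ k) (htr : t ≤ r)
    {F : Finset (Finset V)} (hF : ∀ e ∈ F, e.card = r) (hfree : IsFree F (k * (r - t) + t) k)
    (hfreeℓ : ∀ ℓ, 2 ≤ ℓ → ℓ ≤ k - 1 → IsFree F (ℓ * (r - t) + t - 1) ℓ)
    {P : Finset (V → Fin N)} (hP : ∀ S ⊆ P, 2 ≤ S.card → S.card ≤ k → t < excess t S)
    {T : Finset (Finset V × (V → Fin N))} (hT : T ⊆ F ×ˢ P) (hTk : T.card = k) :
    k * (r - t) + t < (T.biUnion placed).card := by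
  classical
  set U := T.image Prod.snd with hU
  have hsum := sum_card_edgesIn T
  rw [← hU, hTk] at hsum
  have hUP : U ⊆ P := by
    intro b hb
    obtain ⟨p, hp, rfl⟩ := Finset.mem_image.1 hb
    exact (Finset.mem_product.1 (hT hp)).2
  have hUk : U.card ≤ k := hTk ▸ Finset.card_image_le
  have hEF : ∀ b, edgesIn T b ⊆ F := fun b e he =>
    (Finset.mem_product.1 (hT (mem_edgesIn.1 he))).1
  have hE1 : ∀ b ∈ U, 1 ≤ (edgesIn T b).card := by
    intro b hb
    obtain ⟨p, hp, rfl⟩ := Finset.mem_image.1 hb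
    exact Finset.card_pos.2 ⟨p.1, mem_edgesIn.2 hp⟩
  set A : (V → Fin N) → Finset V := fun b => (edgesIn T b).sup id with hA
  have hplaced : ∀ b, placed (A b, b) ⊆ T.biUnion placed := by
    intro b x hx
    obtain ⟨h1, h2⟩ := mem_placed.1 hx
    obtain ⟨e, he, hxe⟩ := Finset.mem_sup.1 h1
    exact Finset.mem_biUnion.2 ⟨(e, b), mem_edgesIn.1 he, mem_placed.2 ⟨hxe, h2⟩⟩
  have hU1 : U.Nonempty := by
    rw [hU, Finset.image_nonempty, ← Finset.card_pos]; omega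
  rcases (Nat.succ_le_of_lt (Finset.card_pos.2 hU1)).eq_or_lt with h1 | h2
  · obtain ⟨b, hb⟩ := Finset.card_eq_one.1 h1.symm
    rw [hb, Finset.sum_singleton] at hsum
    by_contra! hcon
    refine hfree ⟨edgesIn T b, hEF b, hsum, le_trans ?_ hcon⟩
    calc (A b).card = (placed (A b, b)).card := (card_placed (A b, b)).symm
      _ ≤ _ := Finset.card_le_card (hplaced b)
  · have hAcard : ∀ b ∈ U, (edgesIn T b).card * (r - t) + t ≤ (A b).card := by
      intro b hb
      rcases (hE1 b hb).eq_or_lt with h | h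
      · obtain ⟨e, he⟩ := Finset.card_eq_one.1 h.symm
        have heF : e ∈ F := hEF b (he ▸ Finset.mem_singleton_self e)
        simp only [hA, he, Finset.sup_singleton, id, Finset.card_singleton, hF e heF]
        omega
      · have hlt : (edgesIn T b).card < k := by
          obtain ⟨b', hb', hne⟩ := Finset.exists_mem_ne h2 b
          have := Finset.sum_le_sum_of_subset (f := fun b => (edgesIn T b).card)
            (show {b', b} ⊆ U by
              intro x hx
              rcases Finset.mem_insert.1 hx with rfl | hx
              · exact hb'
              · rwa [Finset.mem_singleton.1 hx])
          rw [hsum, Finset.sum_pair hne] at this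
          have := hE1 b' hb'
          omega
        by_contra! hcon
        exact hfreeℓ _ h (by omega) ⟨edgesIn T b, hEF b, rfl, by
          change (A b).card ≤ _
          omega⟩
    have hcover : cover U ⊆
        T.biUnion placed ∪ U.biUnion fun b => blockGraph b \ placed (A b, b) := by
      intro x hx
      obtain ⟨b, hb, hxb⟩ := Finset.mem_biUnion.1 hx
      by_cases hxp : x ∈ placed (A b, b)
      · exact Finset.mem_union_left _ (hplaced b hxp)
      · exact Finset.mem_union_right _
          (Finset.mem_biUnion.2 ⟨b, hb, Finset.mem_sdiff.2 ⟨hxb, hxp⟩⟩)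
    have hsub : ∀ b, placed (A b, b) ⊆ blockGraph b := fun b x hx =>
      mem_blockGraph.2 (mem_placed.1 hx).2
    have hdiff : ∀ b ∈ U, ((blockGraph b \ placed (A b, b)).card : ℤ) ≤
        Fintype.card V - ((edgesIn T b).card * ((r - t : ℕ) : ℤ) + t) := by
      intro b hb
      rw [Finset.cast_card_sdiff (hsub b), card_blockGraph, card_placed]
      have := hAcard b hb
      zify at this
      linarith
    have hle : ((cover U).card : ℤ) ≤ (T.biUnion placed).card +
        ∑ b ∈ U, ((Fintype.card V : ℤ) - ((edgesIn T b).card * ((r - t : ℕ) : ℤ) + t)) := by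
      have h3 := (Finset.card_le_card hcover).trans (Finset.card_union_le _ _)
      have h4 : (U.biUnion fun b => blockGraph b \ placed (A b, b)).card ≤
          ∑ b ∈ U, (blockGraph b \ placed (A b, b)).card := Finset.card_biUnion_le
      have h5 := Finset.sum_le_sum hdiff
      have h6 : ((cover U).card : ℤ) ≤ (T.biUnion placed).card +
          ∑ b ∈ U, ((blockGraph b \ placed (A b, b)).card : ℤ) := by
        exact_mod_cast h3.trans (Nat.add_le_add_left h4 _)
      linarith
    rw [Finset.sum_sub_distrib, Finset.sum_add_distrib, ← Finset.sum_mul, Finset.sum_const,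
      Finset.sum_const, ← Nat.cast_sum, hsum, nsmul_eq_mul, nsmul_eq_mul] at hle
    have hex := hP U hUP h2 hUk
    unfold excess at hex
    zify
    linarith

lemma placed_injOn {k r t : ℕ} (hk : 2 ≤ k) (htr : t < r)
    {F : Finset (Finset V)} (hF : ∀ e ∈ F, e.card = r)
    {P : Finset (V → Fin N)} (hP : ∀ S ⊆ P, 2 ≤ S.card → S.card ≤ k → t < excess t S) :
    Set.InjOn placed (↑(F ×ˢ P) : Set (Finset V × (V → Fin N))) := by
  rintro ⟨e, b⟩ hp ⟨e', b'⟩ hp' h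
  obtain ⟨he, hb⟩ := Finset.mem_product.1 (Finset.mem_coe.1 hp)
  obtain ⟨-, hb'⟩ := Finset.mem_product.1 (Finset.mem_coe.1 hp')
  dsimp only at he hb hb'
  have key : ∀ v, ∀ y : Fin N, v ∈ e ∧ b v = y ↔ v ∈ e' ∧ b' v = y := fun v y => by
    have := Finset.ext_iff.1 h (v, y)
    simpa only [mem_placed] using this
  have hee : e = e' := by
    ext v
    exact ⟨fun hv => ((key v _).1 ⟨hv, rfl⟩).1, fun hv => ((key v _).2 ⟨hv, rfl⟩).1⟩
  have hbb : b = b' := by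
    by_contra hne
    have hex := hP {b, b'} (by
      intro x hx
      rcases Finset.mem_insert.1 hx with rfl | hx
      · exact hb
      · rwa [Finset.mem_singleton.1 hx]) (Finset.card_pair hne).ge
      ((Finset.card_pair hne).trans_le hk)
    rw [excess_pair t hne] at hex
    have hsub : placed (e, b) ⊆ blockGraph b ∩ blockGraph b' := fun x hx =>
      Finset.mem_inter.2 ⟨mem_blockGraph.2 (mem_placed.1 hx).2,
        mem_blockGraph.2 (mem_placed.1 (h ▸ hx)).2⟩
    have := Finset.card_le_card hsub
    rw [card_placed, hF e he] at this
    omega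
  rw [hee, hbb]

end Placement

/-! ### The extremal number -/

section Extremal

lemma bddAbove_card_isFree (r n s k : ℕ) : BddAbove {m : ℕ | ∃ G : Finset (Finset (Fin n)),
    (∀ e ∈ G, e.card = r) ∧ IsFree G s k ∧ G.card = m} := by
  refine ⟨Fintype.card (Finset (Fin n)), ?_⟩
  rintro _ ⟨G, -, -, rfl⟩
  exact Finset.card_le_univ G

lemma card_le_exNum {r n s k : ℕ} {G : Finset (Finset (Fin n))} (hr : ∀ e ∈ G, e.card = r)
    (hG : IsFree G s k) : G.card ≤ exNum r n s k :=
  le_csSup (bddAbove_card_isFree r n s k) ⟨G, hr, hG, rfl⟩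

lemma card_le_of_isFree {k r t n : ℕ} (htr : t ≤ r) {G : Finset (Finset (Fin n))}
    (hr : ∀ e ∈ G, e.card = r) (hG : IsFree G (k * (r - t) + t) k) :
    G.card ≤ k * n ^ t := by
  classical
  have hdeg : ∀ T ∈ powersetCard t (univ : Finset (Fin n)),
      (G.filter fun e => T ⊆ e).card ≤ k := by
    intro T hT
    by_contra! hcon
    obtain ⟨S, hS, hSk⟩ := Finset.exists_subset_card_eq hcon.le
    refine hG ⟨S, hS.trans (Finset.filter_subset _ _), hSk, ?_⟩
    have hTt : T.card = t := (Finset.mem_powersetCard.1 hT).2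
    have hsub : S.sup id ⊆ T ∪ S.biUnion fun e => e \ T := by
      intro x hx
      obtain ⟨e, he, hxe⟩ := Finset.mem_sup.1 hx
      by_cases hxT : x ∈ T
      · exact Finset.mem_union_left _ hxT
      · exact Finset.mem_union_right _
          (Finset.mem_biUnion.2 ⟨e, he, Finset.mem_sdiff.2 ⟨hxe, hxT⟩⟩)
    have h1 := (Finset.card_le_card hsub).trans (Finset.card_union_le _ _)
    have h2 : (S.biUnion fun e => e \ T).card ≤ S.card * (r - t) := by
      refine Finset.card_biUnion_le_card_mul _ _ _ fun e he => ?_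
      obtain ⟨heG, hTe⟩ := Finset.mem_filter.1 (hS he)
      rw [Finset.card_sdiff_of_subset hTe, hr e heG, hTt]
    rw [hSk] at h2
    omega
  have hcov : G ⊆ (powersetCard t (univ : Finset (Fin n))).biUnion
      fun T => G.filter fun e => T ⊆ e := by
    intro e he
    obtain ⟨T, hTe, hTt⟩ := Finset.exists_subset_card_eq (htr.trans (hr e he).ge)
    exact Finset.mem_biUnion.2 ⟨T, Finset.mem_powersetCard.2 ⟨Finset.subset_univ _, hTt⟩,
      Finset.mem_filter.2 ⟨he, hTe⟩⟩
  calc G.card ≤ (powersetCard t (univ : Finset (Fin n))).card * k :=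
        (Finset.card_le_card hcov).trans (Finset.card_biUnion_le_card_mul _ _ _ hdeg)
    _ ≤ k * n ^ t := by
        rw [Finset.card_powersetCard, Finset.card_univ, Fintype.card_fin, mul_comm]
        exact Nat.mul_le_mul_left k (Nat.choose_le_pow n t)

lemma exNum_le {k r t n : ℕ} (hk : 1 ≤ k) (htr : t ≤ r) :
    exNum r n (k * (r - t) + t) k ≤ k * n ^ t := by
  refine csSup_le ⟨0, ∅, by simp, ?_, rfl⟩ ?_
  · rintro ⟨S, hS, hSk, -⟩
    rw [Finset.subset_empty.1 hS, Finset.card_empty] at hSk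
    omega
  · rintro _ ⟨G, hr, hG, rfl⟩
    exact card_le_of_isFree htr hr hG

lemma card_mul_card_le_exNum {V : Type*} [DecidableEq V] [Fintype V] {k r t n N : ℕ}
    (hk : 2 ≤ k) (htr : t < r) {F : Finset (Finset V)} (hF : ∀ e ∈ F, e.card = r)
    (hfree : IsFree F (k * (r - t) + t) k)
    (hfreeℓ : ∀ ℓ, 2 ≤ ℓ → ℓ ≤ k - 1 → IsFree F (ℓ * (r - t) + t - 1) ℓ)
    {P : Finset (V → Fin N)} (hP : ∀ S ⊆ P, 2 ≤ S.card → S.card ≤ k → t < excess t S)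
    (hn : Fintype.card V * N ≤ n) :
    F.card * P.card ≤ exNum r n (k * (r - t) + t) k := by
  classical
  have hcard : Fintype.card (V × Fin N) ≤ Fintype.card (Fin n) := by
    simpa [Fintype.card_prod] using hn
  obtain ⟨φ⟩ := Function.Embedding.nonempty_of_card_le hcard
  have hinj : Set.InjOn (fun p => (placed p).map φ)
      (↑(F ×ˢ P) : Set (Finset V × (V → Fin N))) :=
    (Finset.map_injective φ).comp_injOn (placed_injOn hk htr hF hP)
  have hG : F.card * P.card = ((F ×ˢ P).image fun p => (placed p).map φ).card := by
    rw [Finset.card_image_of_injOn hinj, Finset.card_product]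
  rw [hG]
  refine card_le_exNum ?_ ?_
  · intro e he
    obtain ⟨p, hp, rfl⟩ := Finset.mem_image.1 he
    rw [Finset.card_map, card_placed, hF _ (Finset.mem_product.1 hp).1]
  · rintro ⟨S, hS, hSk, hspan⟩
    obtain ⟨T, hT, rfl⟩ := Finset.subset_image_iff.1 hS
    have hT' : T ⊆ F ×ˢ P := by exact_mod_cast hT
    rw [Finset.card_image_of_injOn (hinj.mono hT)] at hSk
    have hsup : (T.image fun p => (placed p).map φ).sup id = (T.biUnion placed).map φ := by
      ext x
      simp only [Finset.mem_sup, Finset.mem_image, Finset.mem_map, Finset.mem_biUnion, id]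
      constructor
      · rintro ⟨_, ⟨p, hp, rfl⟩, h⟩
        obtain ⟨y, hy, rfl⟩ := Finset.mem_map.1 h
        exact ⟨y, ⟨p, hp, hy⟩, rfl⟩
      · rintro ⟨y, ⟨p, hp, hy⟩, rfl⟩
        exact ⟨_, ⟨p, hp, rfl⟩, Finset.mem_map_of_mem φ hy⟩
    rw [hsup, Finset.card_map] at hspan
    exact absurd (lt_card_biUnion_placed hk htr.le hF hfree hfreeℓ hP hT' hSk) (by omega)

lemma tendsto_natDiv_div {m : ℕ} (hm : 0 < m) :
    Tendsto (fun n : ℕ => ((n / m : ℕ) : ℝ) / n) atTop (nhds (1 / m)) := by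
  have h := (tendsto_nat_floor_mul_div_atTop (R := ℝ) (a := 1 / m) (by positivity)).comp
    tendsto_natCast_atTop_atTop
  refine h.congr fun n => ?_
  simp only [Function.comp]
  rw [one_div, inv_mul_eq_div, Nat.floor_div_natCast, Nat.floor_natCast]

end Extremal

/-- Corollary 5: if `F` is a `(k(r-t)+t, k)`-free `r`-graph on `m` vertices which is also
`(ℓ(r-t)+t-1, ℓ)`-free for all `2 ≤ ℓ ≤ k-1`, then
`liminf n⁻ᵗ f⁽ʳ⁾(n; k(r-t)+t, k) ≥ |F| / mᵗ`. -/
theorem packing_lower_bound_complete {V : Type*} [DecidableEq V] [Fintype V]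
    (k r t m : ℕ) (hk : 2 ≤ k) (hr : 3 ≤ r) (ht : 2 ≤ t) (htr : t ≤ r - 1)
    (hm : Fintype.card V = m)
    (F : Finset (Finset V))
    (hF : ∀ e ∈ F, e.card = r)
    (hfree : IsFree F (k * (r - t) + t) k)
    (hfreeℓ : ∀ ℓ, 2 ≤ ℓ → ℓ ≤ k - 1 → IsFree F (ℓ * (r - t) + t - 1) ℓ) :
    (F.card : ℝ) / (m : ℝ) ^ t ≤
      atTop.liminf (fun n : ℕ => (exNum r n (k * (r - t) + t) k : ℝ) / (n : ℝ) ^ t) := by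
  have hcob : IsCoboundedUnder (· ≥ ·) atTop
      (fun n : ℕ => (exNum r n (k * (r - t) + t) k : ℝ) / (n : ℝ) ^ t) := by
    refine IsBoundedUnder.isCoboundedUnder_ge ⟨k, eventually_map.2 (Eventually.of_forall ?_)⟩
    intro n
    refine div_le_of_le_mul₀ (by positivity) (by positivity) ?_
    exact_mod_cast exNum_le (t := t) (n := n) (by omega : 1 ≤ k) (by omega : t ≤ r)
  rcases F.eq_empty_or_nonempty with rfl | ⟨e, he⟩
  · simp only [Finset.card_empty, Nat.cast_zero, zero_div]
    exact le_liminf_of_le hcob (Eventually.of_forall fun n => by positivity)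
  have htm : t < Fintype.card V := by
    have := Finset.card_le_univ e
    rw [hF e he] at this
    omega
  have hm0 : 0 < m := by omega
  have hlim : ∀ ε : ℝ, 0 < ε → (1 - ε) * F.card * (1 / m : ℝ) ^ t - ε ≤
      atTop.liminf (fun n : ℕ => (exNum r n (k * (r - t) + t) k : ℝ) / (n : ℝ) ^ t) := by
    intro ε hε
    refine le_liminf_of_le hcob ?_
    have htend : Tendsto (fun n : ℕ => (1 - ε) * F.card * (((n / m : ℕ) : ℝ) / n) ^ t) atTop
        (nhds ((1 - ε) * F.card * (1 / m : ℝ) ^ t)) :=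
      ((tendsto_natDiv_div hm0).pow t).const_mul _
    filter_upwards [htend.eventually_const_lt (sub_lt_self _ hε), eventually_gt_atTop 0,
      (Nat.tendsto_div_const_atTop hm0.ne').eventually (exists_packing V hk htm hε)]
      with n hn hn0 ⟨P, hPcard, hP⟩
    refine hn.le.trans ?_
    have hle : F.card * P.card ≤ exNum r n (k * (r - t) + t) k :=
      card_mul_card_le_exNum hk (by omega) hF hfree hfreeℓ hP (by rw [hm]; exact Nat.mul_div_le n m)
    have hle' : (F.card : ℝ) * P.card ≤ exNum r n (k * (r - t) + t) k := by exact_mod_cast hle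
    rw [div_pow, ← mul_div_assoc]
    gcongr
    calc (1 - ε) * F.card * ((n / m : ℕ) : ℝ) ^ t
        = F.card * ((1 - ε) * ((n / m : ℕ) : ℝ) ^ t) := by ring
      _ ≤ F.card * P.card := by gcongr
      _ ≤ _ := hle'
  have htend : Tendsto (fun ε : ℝ => (1 - ε) * F.card * (1 / m : ℝ) ^ t - ε)
      (nhdsWithin 0 (Set.Ioi 0)) (nhds ((1 - 0) * F.card * (1 / m : ℝ) ^ t - 0)) := by
    refine Tendsto.mono_left (Continuous.tendsto ?_ 0) nhdsWithin_le_nhds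
    fun_prop
  have hfin := le_of_tendsto htend (eventually_mem_nhdsWithin.mono fun ε hε => hlim ε hε)
  simpa [div_eq_mul_inv] using hfin
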